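/- arXiv:1206.6791 — 9 statements merged into one kernel-verified Lean document; each statement's English description precedes it below -/
import Mathlib

section
/- Let H and G_1,…,G_m (m ≥ 1) be real Hilbert spaces. For each i ∈ {1,…,m} let L_i : H → G_i be a nonzero bounded linear operator with adjoint L_i*, let β_i > 0, and let T_i : G_i → G_i be β_i-cocoercive. Define T : H → H by T x = Σ_{i=1}^m L_i*(T_i(L_i x)) and set β = 1 / (Σ_{i=1}^m ‖L_i‖²/β_i), where ‖L_i‖ is the operator norm. Then T is β-cocoercive. -/
open RealInnerProductSpace

/-- **Cocoercivity of sums of composed cocoercive operators.**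
If each `T i` is `βv i`-cocoercive on `G i` and `L i : H → G i` are nonzero bounded
linear operators, then `T = ∑ i, (L i)* ∘ T i ∘ L i` is `β`-cocoercive with
`β = 1 / ∑ i, ‖L i‖² / βv i`. -/
theorem sum_composite_cocoercive
    {H : Type*} [NormedAddCommGroup H] [InnerProductSpace ℝ H] [CompleteSpace H]
    {m : ℕ} (hm : 0 < m)
    (G : Fin m → Type*) [∀ i, NormedAddCommGroup (G i)] [∀ i, InnerProductSpace ℝ (G i)]
    [∀ i, CompleteSpace (G i)]
    (L : ∀ i, H →L[ℝ] G i) (hL : ∀ i, L i ≠ 0)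
    (βv : Fin m → ℝ) (hβv : ∀ i, 0 < βv i)
    (T : ∀ i, G i → G i)
    (hT : ∀ i, ∀ x y : G i, ⟪x - y, T i x - T i y⟫ ≥ βv i * ‖T i x - T i y‖ ^ 2)
    (Tsum : H → H)
    (hTsum : ∀ x, Tsum x = ∑ i, (ContinuousLinearMap.adjoint (L i)) (T i (L i x)))
    (β : ℝ) (hβ : β = 1 / ∑ i, ‖L i‖ ^ 2 / βv i) :
    ∀ x y : H, ⟪x - y, Tsum x - Tsum y⟫ ≥ β * ‖Tsum x - Tsum y‖ ^ 2 := by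
  intro x y
  set d : ∀ i, G i := fun i => T i (L i x) - T i (L i y) with hd
  have hdiff : Tsum x - Tsum y = ∑ i, ContinuousLinearMap.adjoint (L i) (d i) := by
    simp only [hTsum, hd, map_sub, Finset.sum_sub_distrib]
  have hmono : ∑ i, βv i * ‖d i‖ ^ 2 ≤ ⟪x - y, Tsum x - Tsum y⟫ := by
    rw [hdiff, inner_sum]
    refine Finset.sum_le_sum fun i _ => ?_
    rw [ContinuousLinearMap.adjoint_inner_right, map_sub]
    exact hT i (L i x) (L i y)
  have hnorm : ‖Tsum x - Tsum y‖ ≤ ∑ i, ‖L i‖ * ‖d i‖ := by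
    rw [hdiff]
    refine norm_sum_le_of_le _ fun i _ => ?_
    simpa using (ContinuousLinearMap.adjoint (L i)).le_opNorm (d i)
  have hcs : (∑ i, ‖L i‖ * ‖d i‖) ^ 2 ≤
      (∑ i, βv i * ‖d i‖ ^ 2) * ∑ i, ‖L i‖ ^ 2 / βv i := by
    refine Finset.sum_sq_le_sum_mul_sum_of_sq_le_mul _ (fun i _ => ?_) (fun i _ => ?_)
      fun i _ => ?_
    · have := hβv i
      positivity
    · have := hβv i
      positivity
    · refine le_of_eq ?_
      have := (hβv i).ne'
      field_simp
  refine ge_iff_le.mpr (le_trans ?_ hmono)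
  rw [hβ, one_div_mul_eq_div]
  refine div_le_of_le_mul₀ ?_ ?_ ((pow_le_pow_left₀ (norm_nonneg _) hnorm 2).trans hcs)
  · exact Finset.sum_nonneg fun i _ => div_nonneg (sq_nonneg _) (hβv i).le
  · exact Finset.sum_nonneg fun i _ => mul_nonneg (hβv i).le (sq_nonneg _)
end

section
/- Let H be a real Hilbert space, α > 0, U ∈ P_α(H), and let A : H → Set H be maximally monotone. Then the operator UA : x ↦ {U u : u ∈ A x} is maximally monotone with respect to the inner product ⟪x,y⟫_{U⁻¹} := ⟪U⁻¹x, y⟫; explicitly: (monotonicity) for all x, y and all u' ∈ {Uu : u ∈ Ax}, v' ∈ {Uv : v ∈ Ay} one has ⟪U⁻¹(x−y), u'−v'⟫ ≥ 0, and (maximality) whenever (y,v') ∈ H×H satisfies ⟪U⁻¹(x−y), u'−v'⟫ ≥ 0 for all x and all u' ∈ {Uu : u ∈ Ax}, then U⁻¹v' ∈ A y. -/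
open RealInnerProductSpace

/-- **Maximal monotonicity of `U ∘ A` in the metric induced by `U⁻¹`.**
If `A` is maximally monotone on a real Hilbert space `H` and `U ∈ P_α(H)` (with
inverse `Uinv`), then the operator `x ↦ {U u : u ∈ A x}` is maximally monotone with
respect to the inner product `(x, y) ↦ ⟪Uinv x, y⟫`. -/
theorem UA_maximally_monotone
    {H : Type*} [NormedAddCommGroup H] [InnerProductSpace ℝ H] [CompleteSpace H]
    (α : ℝ) (hα : 0 < α)
    (U Uinv : H →L[ℝ] H) (hUsa : IsSelfAdjoint U)
    (hUα : ∀ x : H, ⟪U x, x⟫ ≥ α * ‖x‖ ^ 2)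
    (hUinv₁ : ∀ x : H, Uinv (U x) = x) (hUinv₂ : ∀ x : H, U (Uinv x) = x)
    (A : H → Set H)
    (hAmono : ∀ x y u v : H, u ∈ A x → v ∈ A y → ⟪x - y, u - v⟫ ≥ 0)
    (hAmax : ∀ y v : H, (∀ x u : H, u ∈ A x → ⟪x - y, u - v⟫ ≥ 0) → v ∈ A y) :
    (∀ x y u' v' : H, u' ∈ (fun u => U u) '' A x → v' ∈ (fun u => U u) '' A y →
      ⟪Uinv (x - y), u' - v'⟫ ≥ 0) ∧
    (∀ y v' : H, (∀ x u' : H, u' ∈ (fun u => U u) '' A x → ⟪Uinv (x - y), u' - v'⟫ ≥ 0) →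
      Uinv v' ∈ A y) := by
  have key (a b : H) : ⟪Uinv a, U b⟫ = ⟪a, b⟫ := by
    have h := hUsa.isSymmetric (Uinv a) b
    simp only [ContinuousLinearMap.coe_coe, hUinv₂] at h
    exact h.symm
  constructor
  · rintro x y _ _ ⟨u, hu, rfl⟩ ⟨v, hv, rfl⟩
    simp only [← map_sub U, key]
    exact hAmono x y u v hu hv
  · intro y v' h
    refine hAmax y (Uinv v') fun x u hu => ?_
    rw [← key, map_sub U, hUinv₂]
    exact h x (U u) ⟨u, hu, rfl⟩
end

section
/- Let H be a real Hilbert space, α > 0, U ∈ P_α(H), and let A : H → Set H be maximally monotone. Then for every x ∈ H there exists a unique p ∈ H such that x − p ∈ {U u : u ∈ A p}; denoting this p by J_{UA}(x), the map J_{UA} : H → H is firmly nonexpansive in the metric induced by U⁻¹, i.e. for all x, y ∈ H, ⟪U⁻¹(x−y), J_{UA}(x) − J_{UA}(y)⟫ ≥ ⟪U⁻¹(J_{UA}(x) − J_{UA}(y)), J_{UA}(x) − J_{UA}(y)⟫. -/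
open RealInnerProductSpace

open Filter Topology in
/-- A coercive quadratic function plus the last coordinate attains its infimum on a closed
midpoint-convex set on which it is bounded below. -/
theorem exists_isMinOn_quadratic_add_snd {E : Type*} [NormedAddCommGroup E] [NormedSpace ℝ E]
    [CompleteSpace E] {Q : E → ℝ} (hQc : Continuous Q) {c : ℝ} (hc : 0 < c)
    (hQ : ∀ e, c * ‖e‖ ^ 2 ≤ Q e)
    (hpar : ∀ a b, Q ((1 / 2 : ℝ) • (a + b)) = (Q a + Q b) / 2 - Q (a - b) / 4)
    {S : Set (E × ℝ)} (hS : IsClosed S) (hne : S.Nonempty)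
    (hmid : ∀ a ∈ S, ∀ b ∈ S, (1 / 2 : ℝ) • (a + b) ∈ S)
    (hbdd : BddBelow ((fun w : E × ℝ => Q w.1 + w.2) '' S)) :
    ∃ z ∈ S, ∀ w ∈ S, Q z.1 + z.2 ≤ Q w.1 + w.2 := by
  set g : E × ℝ → ℝ := fun w => Q w.1 + w.2 with hg
  set m := sInf (g '' S) with hm
  have hlow : ∀ w ∈ S, m ≤ g w := fun w hw => csInf_le hbdd ⟨w, hw, rfl⟩
  have hseq : ∀ n : ℕ, ∃ w ∈ S, g w < m + 1 / ((n : ℝ) + 1) := by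
    intro n
    obtain ⟨_, ⟨w, hw, rfl⟩, h⟩ := exists_lt_of_csInf_lt (hne.image g)
      (show sInf (g '' S) < m + 1 / ((n : ℝ) + 1) from lt_add_of_pos_right _ (by positivity))
    exact ⟨w, hw, h⟩
  choose w hwS hwm using hseq
  have hdist : ∀ a ∈ S, ∀ b ∈ S, ∀ ε, g a ≤ m + ε → g b ≤ m + ε →
      c * ‖a.1 - b.1‖ ^ 2 ≤ 4 * ε := by
    intro a ha b hb ε h1 h2
    have h3 := hlow _ (hmid a ha b hb)
    have h4 := hpar a.1 b.1
    have h5 := hQ (a.1 - b.1)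
    simp only [hg, Prod.smul_fst, Prod.fst_add, Prod.smul_snd, Prod.snd_add, smul_eq_mul]
      at h1 h2 h3
    linarith
  have hcauchy : CauchySeq (fun n => (w n).1) := by
    refine Metric.cauchySeq_iff'.2 fun ε hε => ?_
    obtain ⟨N, hN⟩ := exists_nat_one_div_lt (show 0 < c * ε ^ 2 / 4 by positivity)
    refine ⟨N, fun n hn => ?_⟩
    have hle : 1 / ((n : ℝ) + 1) ≤ 1 / ((N : ℝ) + 1) := Nat.one_div_le_one_div hn
    have h := hdist _ (hwS n) _ (hwS N) (1 / ((N : ℝ) + 1))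
      (by linarith [hwm n]) (hwm N).le
    rw [dist_eq_norm]
    refine lt_of_pow_lt_pow_left₀ 2 hε.le ?_
    nlinarith
  obtain ⟨e, he⟩ := cauchySeq_tendsto_of_complete hcauchy
  have hgm : Tendsto (fun n => g (w n)) atTop (𝓝 m) := by
    refine tendsto_of_tendsto_of_tendsto_of_le_of_le tendsto_const_nhds ?_
      (fun n => hlow _ (hwS n)) (fun n => (hwm n).le)
    simpa using (tendsto_const_nhds (x := m)).add
      (tendsto_one_div_add_atTop_nhds_zero_nat (𝕜 := ℝ))
  have ht : Tendsto (fun n => (w n).2) atTop (𝓝 (m - Q e)) := by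
    have := hgm.sub ((hQc.tendsto e).comp he)
    simpa [hg, Function.comp_def] using this
  refine ⟨(e, m - Q e), hS.mem_of_tendsto (he.prodMk_nhds ht) (Eventually.of_forall hwS), ?_⟩
  intro v hv
  have := hlow v hv
  simp only [hg] at this
  simpa using this

/-- Nonnegativity of the linear part of a quadratic polynomial that is nonnegative on `(0, 1]`. -/
theorem nonneg_of_forall_mul_add_sq_mul_nonneg {a b : ℝ}
    (h : ∀ s : ℝ, 0 < s → s ≤ 1 → 0 ≤ s * a + s ^ 2 * b) : 0 ≤ a := by
  by_contra! ha
  have hb : 0 < |b| + 1 - a := by linarith [abs_nonneg b]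
  have hs : 0 < -a / (|b| + 1 - a) := div_pos (by linarith) hb
  have h1 := h _ hs ((div_le_one hb).2 (by linarith [abs_nonneg b]))
  set s := -a / (|b| + 1 - a) with hsd
  have hsb : s * (|b| + 1 - a) = -a := div_mul_cancel₀ _ hb.ne'
  have h2 : 0 ≤ a + s * b := by
    by_contra! h3
    nlinarith
  nlinarith [le_abs_self b, mul_le_mul_of_nonneg_left (le_abs_self b) hs.le,
    mul_pos hs (show 0 < 1 - a by linarith)]

section

variable {H : Type*} [NormedAddCommGroup H] [InnerProductSpace ℝ H]

/-- The epigraph of the Fitzpatrick function of `A`. -/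
def fitzpatrickEpigraph (A : H → Set H) : Set ((H × H) × ℝ) :=
  {w | ∀ y v : H, v ∈ A y → ⟪w.1.1, v⟫ + ⟪y, w.1.2⟫ - ⟪y, v⟫ ≤ w.2}

theorem isClosed_fitzpatrickEpigraph (A : H → Set H) : IsClosed (fitzpatrickEpigraph A) := by
  simp only [fitzpatrickEpigraph, Set.ofPred_forall]
  refine isClosed_iInter fun y => isClosed_iInter fun v => isClosed_iInter fun _ => ?_
  exact isClosed_le (by fun_prop) (by fun_prop)

theorem convex_fitzpatrickEpigraph (A : H → Set H) : Convex ℝ (fitzpatrickEpigraph A) := by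
  intro a ha b hb s t hs ht hst y v hv
  have h1 := mul_le_mul_of_nonneg_left (ha y v hv) hs
  have h2 := mul_le_mul_of_nonneg_left (hb y v hv) ht
  simp only [Prod.smul_fst, Prod.fst_add, Prod.smul_snd, Prod.snd_add, smul_eq_mul,
    inner_add_left, inner_add_right, real_inner_smul_left, real_inner_smul_right]
  have h3 : ⟪y, v⟫ = s * ⟪y, v⟫ + t * ⟪y, v⟫ := by rw [← add_mul, hst, one_mul]
  linarith

theorem mem_fitzpatrickEpigraph_of_mem {A : H → Set H}
    (hA : ∀ x y u v : H, u ∈ A x → v ∈ A y → 0 ≤ ⟪x - y, u - v⟫) {y v : H} (hv : v ∈ A y) :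
    ((y, v), ⟪y, v⟫) ∈ fitzpatrickEpigraph A := by
  intro y' v' hv'
  have := hA _ _ _ _ hv hv'
  simp only [inner_sub_left, inner_sub_right] at this ⊢
  linarith

/-- The Fitzpatrick function of a maximal operator dominates the duality pairing. -/
theorem inner_le_of_mem_fitzpatrickEpigraph {A : H → Set H}
    (hA : ∀ y v : H, (∀ x u : H, u ∈ A x → 0 ≤ ⟪x - y, u - v⟫) → v ∈ A y)
    {w : (H × H) × ℝ} (hw : w ∈ fitzpatrickEpigraph A) : ⟪w.1.1, w.1.2⟫ ≤ w.2 := by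
  by_contra! hlt
  have hmem : w.1.2 ∈ A w.1.1 := by
    refine hA _ _ fun x u hu => ?_
    have := hw x u hu
    simp only [inner_sub_left, inner_sub_right]
    linarith
  have := hw _ _ hmem
  linarith

theorem inner_inverse_coercive {U V : H →L[ℝ] H} {α : ℝ} (hα : 0 < α)
    (hU : ∀ x : H, α * ‖x‖ ^ 2 ≤ ⟪U x, x⟫) (hUV : ∀ x : H, U (V x) = x) (x : H) :
    α / (‖U‖ + 1) ^ 2 * ‖x‖ ^ 2 ≤ ⟪V x, x⟫ := by
  have h1 := hU (V x)
  rw [hUV, real_inner_comm] at h1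
  refine le_trans ?_ h1
  have h2 : ‖x‖ ≤ (‖U‖ + 1) * ‖V x‖ := by
    have := U.le_opNorm (V x)
    rw [hUV] at this
    nlinarith [norm_nonneg (V x)]
  have h3 : ‖x‖ ^ 2 ≤ (‖U‖ + 1) ^ 2 * ‖V x‖ ^ 2 := by
    rw [← mul_pow]
    gcongr
  rw [div_mul_eq_mul_div, div_le_iff₀ (by positivity)]
  nlinarith

/-- **Minty's theorem** in the metric of a coercive self-adjoint operator: a maximally monotone
operator `A` admits a point `p` with `-U⁻¹ p ∈ A p`. -/
theorem exists_neg_inverse_mem_of_maximal_monotone [CompleteSpace H] {α : ℝ} (hα : 0 < α)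
    {U V : H →L[ℝ] H} (hUsymm : ∀ x y : H, ⟪U x, y⟫ = ⟪x, U y⟫)
    (hU : ∀ x : H, α * ‖x‖ ^ 2 ≤ ⟪U x, x⟫) (hUV : ∀ x : H, U (V x) = x) {A : H → Set H}
    (hAmono : ∀ x y u v : H, u ∈ A x → v ∈ A y → 0 ≤ ⟪x - y, u - v⟫)
    (hAmax : ∀ y v : H, (∀ x u : H, u ∈ A x → 0 ≤ ⟪x - y, u - v⟫) → v ∈ A y) :
    ∃ p : H, -V p ∈ A p := by
  have hVsymm : ∀ x y : H, ⟪V x, y⟫ = ⟪x, V y⟫ := fun x y => by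
    have := hUsymm (V x) (V y)
    rw [hUV, hUV] at this
    exact this.symm
  have hpair : ∀ x y : H, ⟪U x, V y⟫ = ⟪x, y⟫ := fun x y => by rw [hUsymm, hUV]
  have hsq : ∀ x y : H, 2 * ⟪x, y⟫ + ⟪V x, x⟫ + ⟪U y, y⟫ = ⟪U (V x + y), V x + y⟫ := by
    intro x y
    rw [map_add, hUV, inner_add_left, inner_add_right, inner_add_right, hpair,
      real_inner_comm x (V x), real_inner_comm x y]
    ring
  have hpos : ∀ x : H, 0 ≤ ⟪U x, x⟫ := fun x => le_trans (by positivity) (hU x)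
  have hV := inner_inverse_coercive hα hU hUV
  set β := α / (‖U‖ + 1) ^ 2 with hβ
  have hβpos : 0 < β := by positivity
  let Q : H × H → ℝ := fun e => (⟪V e.1, e.1⟫ + ⟪U e.2, e.2⟫) / 2
  have hexp : ∀ (z d : H × H) (s : ℝ),
      Q (z + s • d) = Q z + s * (⟪V z.1, d.1⟫ + ⟪U z.2, d.2⟫) + s ^ 2 * Q d := by
    intro z d s
    simp only [Q, Prod.fst_add, Prod.snd_add, Prod.smul_fst, Prod.smul_snd, map_add, map_smul,
      inner_add_left, inner_add_right, real_inner_smul_left, real_inner_smul_right]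
    rw [hVsymm d.1 z.1, hUsymm d.2 z.2, real_inner_comm (V z.1) d.1,
      real_inner_comm (U z.2) d.2]
    ring
  have hne : (fitzpatrickEpigraph A).Nonempty := by
    by_cases h : ∃ y v, v ∈ A y
    · obtain ⟨y, v, hv⟩ := h
      exact ⟨_, mem_fitzpatrickEpigraph_of_mem hAmono hv⟩
    · push Not at h
      exact absurd (hAmax 0 0 fun x u hu => absurd hu (h x u)) (h 0 0)
  obtain ⟨⟨z, t⟩, hzS, hmin⟩ := exists_isMinOn_quadratic_add_snd (Q := Q)
    (c := min β α / 2) (by fun_prop) (by positivity)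
    (by
      intro e
      have h1 := hV e.1
      have h2 := hU e.2
      have h3 : min β α * ‖e.1‖ ^ 2 ≤ β * ‖e.1‖ ^ 2 := by gcongr; exact min_le_left _ _
      have h4 : min β α * ‖e.2‖ ^ 2 ≤ α * ‖e.2‖ ^ 2 := by gcongr; exact min_le_right _ _
      have h5 : 0 ≤ min β α * ‖e.1‖ ^ 2 := by positivity
      have h6 : 0 ≤ min β α * ‖e.2‖ ^ 2 := by positivity
      simp only [Q]
      rcases max_choice ‖e.1‖ ‖e.2‖ with h | h <;> rw [Prod.norm_def, h] <;> linarith)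
    (by
      intro a b
      have h1 := hexp b (a - b) (1 / 2)
      have h2 := hexp b (a - b) 1
      have h3 : b + (1 / 2 : ℝ) • (a - b) = (1 / 2 : ℝ) • (a + b) := by module
      have h4 : b + (1 : ℝ) • (a - b) = a := by module
      rw [h3] at h1
      rw [h4] at h2
      linarith)
    (isClosed_fitzpatrickEpigraph A) hne
    (by
      intro a ha b hb
      rw [smul_add]
      exact convex_fitzpatrickEpigraph A ha hb (by norm_num) (by norm_num) (by norm_num))
    (by
      refine ⟨0, ?_⟩
      rintro _ ⟨w, hw, rfl⟩
      have h1 := inner_le_of_mem_fitzpatrickEpigraph hAmax hw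
      have h2 := hsq w.1.1 w.1.2
      have h3 := hpos (V w.1.1 + w.1.2)
      simp only [Q]
      linarith)
  have hopt : ∀ y v : H, v ∈ A y →
      0 ≤ ⟪V z.1, y - z.1⟫ + ⟪U z.2, v - z.2⟫ + (⟪y, v⟫ - t) := by
    intro y v hv
    refine nonneg_of_forall_mul_add_sq_mul_nonneg (b := Q ((y, v) - z)) fun s hs hs1 => ?_
    have hmem := convex_fitzpatrickEpigraph A hzS (mem_fitzpatrickEpigraph_of_mem hAmono hv)
      (sub_nonneg.2 hs1) hs.le (by ring)
    have h1 := hmin _ hmem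
    have h2 := hexp z ((y, v) - z) s
    have h3 : (1 - s) • z + s • (y, v) = z + s • ((y, v) - z) := by module
    simp only [Prod.smul_mk, Prod.mk_add_mk, smul_eq_mul] at h1
    simp only [Prod.smul_mk] at h3
    rw [h3, h2] at h1
    simp only [Prod.fst_sub, Prod.snd_sub] at h1
    linarith
  have ht := inner_le_of_mem_fitzpatrickEpigraph hAmax hzS
  have hlow : ∀ y v : H, v ∈ A y →
      ⟪U (V z.1 + z.2), V z.1 + z.2⟫ ≤ ⟪y - -U z.2, v - -V z.1⟫ := by
    intro y v hv
    have h1 := hopt y v hv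
    rw [← hsq]
    simp only [sub_neg_eq_add, inner_add_left, inner_add_right, inner_sub_right, hpair] at h1 ⊢
    rw [real_inner_comm (V z.1) y, real_inner_comm z.1 z.2]
    dsimp only at ht
    linarith
  have hmem : -V z.1 ∈ A (-U z.2) := hAmax _ _ fun y v hv => (hpos _).trans (hlow y v hv)
  have hzero : V z.1 + z.2 = 0 := by
    have h1 := hlow _ _ hmem
    rw [sub_self, inner_zero_left] at h1
    have h2 := (hU _).trans h1
    have h3 : ‖V z.1 + z.2‖ ^ 2 ≤ 0 := by
      by_contra! h
      nlinarith
    exact norm_eq_zero.1 (pow_eq_zero_iff two_ne_zero |>.1 (le_antisymm h3 (sq_nonneg _)))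
  refine ⟨z.1, ?_⟩
  have hz : -U z.2 = z.1 := by
    rw [← neg_eq_of_add_eq_zero_right hzero, map_neg, neg_neg, hUV]
  rwa [hz] at hmem

end

/-- **The resolvent `J_{UA}` is well defined and firmly nonexpansive in the `U⁻¹` metric.**
For `A` maximally monotone and `U ∈ P_α(H)` with inverse `Uinv`: for every `x` there is a
unique `p` with `x − p ∈ {U u : u ∈ A p}`, and any map `J` selecting this point satisfies
`⟪Uinv (x−y), J x − J y⟫ ≥ ⟪Uinv (J x − J y), J x − J y⟫` for all `x, y`. -/
theorem resolvent_UA_firmly_nonexpansive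
    {H : Type*} [NormedAddCommGroup H] [InnerProductSpace ℝ H] [CompleteSpace H]
    (α : ℝ) (hα : 0 < α)
    (U Uinv : H →L[ℝ] H) (hUsa : IsSelfAdjoint U)
    (hUα : ∀ x : H, ⟪U x, x⟫ ≥ α * ‖x‖ ^ 2)
    (hUinv₁ : ∀ x : H, Uinv (U x) = x) (hUinv₂ : ∀ x : H, U (Uinv x) = x)
    (A : H → Set H)
    (hAmono : ∀ x y u v : H, u ∈ A x → v ∈ A y → ⟪x - y, u - v⟫ ≥ 0)
    (hAmax : ∀ y v : H, (∀ x u : H, u ∈ A x → ⟪x - y, u - v⟫ ≥ 0) → v ∈ A y) :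
    (∀ x : H, ∃! p : H, x - p ∈ (fun u => U u) '' A p) ∧
    (∀ J : H → H, (∀ x : H, x - J x ∈ (fun u => U u) '' A (J x)) →
      ∀ x y : H, ⟪Uinv (x - y), J x - J y⟫ ≥ ⟪Uinv (J x - J y), J x - J y⟫) := by
  have hUsymm : ∀ x y : H, ⟪U x, y⟫ = ⟪x, U y⟫ := fun x y => hUsa.isSymmetric x y
  have hVpos := inner_inverse_coercive hα hUα hUinv₂
  have hmem : ∀ {x p : H}, x - p ∈ (fun u => U u) '' A p ↔ Uinv (x - p) ∈ A p := by
    intro x p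
    constructor
    · rintro ⟨u, hu, h⟩
      rwa [← h, hUinv₁]
    · exact fun h => ⟨_, h, hUinv₂ _⟩
  have hfirm : ∀ {x y p q : H}, x - p ∈ (fun u => U u) '' A p →
      y - q ∈ (fun u => U u) '' A q →
      ⟪Uinv (x - y), p - q⟫ ≥ ⟪Uinv (p - q), p - q⟫ := by
    intro x y p q hp hq
    have h := hAmono _ _ _ _ (hmem.1 hp) (hmem.1 hq)
    rw [← map_sub, show x - p - (y - q) = x - y - (p - q) by abel, map_sub, inner_sub_right,
      real_inner_comm, real_inner_comm (Uinv (p - q))] at h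
    linarith
  refine ⟨fun x => ?_, fun J hJ x y => hfirm (hJ x) (hJ y)⟩
  obtain ⟨p, hp⟩ := exists_neg_inverse_mem_of_maximal_monotone hα hUsymm hUα hUinv₂
    (A := fun p => {u | u + Uinv x ∈ A p})
    (by
      intro a b u v hu hv
      have := hAmono _ _ _ _ hu hv
      rwa [add_sub_add_right_eq_sub] at this)
    (by
      intro y v h
      refine hAmax _ _ fun a u hu => ?_
      have := h a (u - Uinv x) (by simpa using hu)
      rwa [sub_sub, add_comm (Uinv x)] at this)
  have hpx : x - p ∈ (fun u => U u) '' A p := by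
    rw [hmem, map_sub, sub_eq_neg_add]
    exact hp
  refine ⟨p, hpx, fun q hq => ?_⟩
  have h1 := hfirm hq hpx
  rw [sub_self, map_zero, inner_zero_left] at h1
  have h2 := (hVpos (q - p)).trans h1
  have h3 : ‖q - p‖ ^ 2 ≤ 0 := nonpos_of_mul_nonpos_right h2 (by positivity)
  exact sub_eq_zero.1
    (norm_eq_zero.1 (pow_eq_zero_iff two_ne_zero |>.1 (le_antisymm h3 (sq_nonneg _))))
end

section
/- Let H be a real Hilbert space, α > 0, γ > 0, U ∈ P_α(H), and let A : H → Set H be maximally monotone. Then for all x, p ∈ H the following are equivalent: (a) there exists u ∈ A p with x − p = γ U u (i.e. p = J_{γUA}(x)); (b) there exists q ∈ H such that p = x − γ U q and there exists w ∈ H with q ∈ A w and γ⁻¹U⁻¹x − q = γ⁻¹U⁻¹w (i.e. q = J_{γ⁻¹U⁻¹A⁻¹}(γ⁻¹U⁻¹x), where A⁻¹ q = {w : q ∈ A w}). In other words, J_{γUA} = Id − γ U ∘ J_{γ⁻¹U⁻¹A⁻¹} ∘ (γ⁻¹U⁻¹). -/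
open RealInnerProductSpace

/-- **Resolvent identity `J_{γUA} = Id − γU ∘ J_{γ⁻¹U⁻¹A⁻¹} ∘ (γ⁻¹U⁻¹)`.**
For `A` maximally monotone, `γ > 0` and `U ∈ P_α(H)` with inverse `Uinv`:
`p = J_{γUA}(x)` iff `p = x − γ U q` where `q = J_{γ⁻¹U⁻¹A⁻¹}(γ⁻¹ Uinv x)`. -/
theorem resolvent_identity_variable_metric
    {H : Type*} [NormedAddCommGroup H] [InnerProductSpace ℝ H] [CompleteSpace H]
    (α : ℝ) (hα : 0 < α) (γ : ℝ) (hγ : 0 < γ)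
    (U Uinv : H →L[ℝ] H) (hUsa : IsSelfAdjoint U)
    (hUα : ∀ x : H, ⟪U x, x⟫ ≥ α * ‖x‖ ^ 2)
    (hUinv₁ : ∀ x : H, Uinv (U x) = x) (hUinv₂ : ∀ x : H, U (Uinv x) = x)
    (A : H → Set H)
    (hAmono : ∀ x y u v : H, u ∈ A x → v ∈ A y → ⟪x - y, u - v⟫ ≥ 0)
    (hAmax : ∀ y v : H, (∀ x u : H, u ∈ A x → ⟪x - y, u - v⟫ ≥ 0) → v ∈ A y) :
    ∀ x p : H,
      (∃ u ∈ A p, x - p = γ • U u) ↔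
      (∃ q : H, p = x - γ • U q ∧
        ∃ w : H, q ∈ A w ∧ γ⁻¹ • Uinv x - q = γ⁻¹ • Uinv w) := by
  intro x p
  constructor
  · rintro ⟨u, hu, hxp⟩
    refine ⟨u, by rw [← hxp, sub_sub_cancel], p, hu, ?_⟩
    have h : Uinv x - Uinv p = γ • u := by rw [← map_sub, hxp, map_smul, hUinv₁]
    rw [sub_eq_iff_eq_add, ← sub_eq_iff_eq_add', ← smul_sub, h, inv_smul_smul₀ hγ.ne']
  · rintro ⟨q, hp, w, hqw, h⟩
    have hq : q = γ⁻¹ • Uinv (x - w) := by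
      rw [map_sub, smul_sub, ← h, sub_sub_cancel]
    have hUq : γ • U q = x - w := by
      rw [hq, map_smul, hUinv₂, smul_inv_smul₀ hγ.ne']
    have hpw : p = w := by rw [hp, hUq, sub_sub_cancel]
    exact ⟨q, hpw ▸ hqw, by rw [hUq, hpw]⟩
end

section
/- Let H be a real Hilbert space, α > 0, U ∈ P_α(H), let u ∈ H with u ≠ 0, let φ ∈ Γ₀(ℝ), and set c := ⟪U⁻¹u, u⟫ (note c > 0). Fix x ∈ H and suppose s ∈ ℝ satisfies c·φ(s) + (1/2)(⟪x,u⟫ − s)² ≤ c·φ(t) + (1/2)(⟪x,u⟫ − t)² for all t ∈ ℝ (EReal arithmetic, real numbers coerced into EReal). Then the point p := x + ((s − ⟪x,u⟫)/c)·U⁻¹u satisfies, for all y ∈ H, φ(⟪p,u⟫) + (1/2)⟪U(x−p), x−p⟫ ≤ φ(⟪y,u⟫) + (1/2)⟪U(x−y), x−y⟫; that is, p = prox^U_g(x) for g = φ(⟪·,u⟫). -/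
open RealInnerProductSpace

/-- Cauchy–Schwarz inequality for a positive symmetric operator `U`, tested against a vector `v`. -/
theorem inner_sq_div_le_of_symmetric_nonneg {H : Type*} [NormedAddCommGroup H]
    [InnerProductSpace ℝ H] (U : H →L[ℝ] H) (hsymm : ∀ a b : H, ⟪U a, b⟫ = ⟪a, U b⟫)
    (hnonneg : ∀ a : H, 0 ≤ ⟪U a, a⟫) (v d : H) (hv : 0 < ⟪v, U v⟫) :
    ⟪d, U v⟫ ^ 2 / ⟪v, U v⟫ ≤ ⟪U d, d⟫ := by
  have h := hnonneg (d - (⟪d, U v⟫ / ⟪v, U v⟫) • v)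
  have hdv : ⟪U d, v⟫ = ⟪d, U v⟫ := hsymm d v
  have hvd : ⟪U v, d⟫ = ⟪d, U v⟫ := real_inner_comm _ _
  have hvv : ⟪U v, v⟫ = ⟪v, U v⟫ := hsymm v v
  simp only [map_sub, map_smul, inner_sub_left, inner_sub_right, real_inner_smul_left,
    real_inner_smul_right, hdv, hvd, hvv] at h
  field_simp at h ⊢
  linarith

/-- In `EReal`, a minimality inequality with weight `c > 0` on the function may be divided by `c`. -/
theorem EReal.add_coe_div_le_of_mul_add_coe_le {c : ℝ} (hc : 0 < c) {a b : EReal}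
    (ha : a ≠ ⊥) (hb : b ≠ ⊥) {q r : ℝ}
    (h : (c : EReal) * a + (q : EReal) ≤ (c : EReal) * b + (r : EReal)) :
    a + ((q / c : ℝ) : EReal) ≤ b + ((r / c : ℝ) : EReal) := by
  induction b with
  | bot => exact absurd rfl hb
  | top => simp
  | coe b =>
    induction a with
    | bot => exact absurd rfl ha
    | top =>
      rw [EReal.coe_mul_top_of_pos hc, EReal.top_add_coe, top_le_iff] at h
      exact absurd h (EReal.coe_ne_top (c * b + r))
    | coe a =>
      norm_cast at h ⊢
      field_simp
      linarith

/-- **Proximity operator of `φ(⟪·,u⟫)` in the metric induced by `U`.**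
If `φ ∈ Γ₀(ℝ)`, `u ≠ 0`, `c = ⟪U⁻¹u, u⟫`, and `s` minimizes
`t ↦ c·φ(t) + (1/2)(⟪x,u⟫ − t)²` over `ℝ`, then
`p = x + ((s − ⟪x,u⟫)/c)·U⁻¹u` is the prox of `g = φ(⟪·,u⟫)` at `x` for the metric
`(x,y) ↦ ⟪U x, y⟫`. -/
theorem prox_of_linear_composition
    {H : Type*} [NormedAddCommGroup H] [InnerProductSpace ℝ H] [CompleteSpace H]
    (α : ℝ) (hα : 0 < α)
    (U Uinv : H →L[ℝ] H) (hUsa : IsSelfAdjoint U)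
    (hUα : ∀ x : H, ⟪U x, x⟫ ≥ α * ‖x‖ ^ 2)
    (hUinv₁ : ∀ x : H, Uinv (U x) = x) (hUinv₂ : ∀ x : H, U (Uinv x) = x)
    (u : H) (hu : u ≠ 0)
    (φ : ℝ → EReal)
    (hφbot : ∀ t : ℝ, φ t ≠ ⊥)
    (hφproper : ∃ t : ℝ, φ t ≠ ⊤)
    (hφlsc : LowerSemicontinuous φ)
    (hφconv : ∀ s t : ℝ, ∀ a : ℝ, a ∈ Set.Icc (0:ℝ) 1 →
      φ (a * s + (1 - a) * t) ≤ (a : EReal) * φ s + ((1 - a : ℝ) : EReal) * φ t)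
    (c : ℝ) (hc : c = ⟪Uinv u, u⟫)
    (x : H) (s : ℝ)
    (hs : ∀ t : ℝ,
      (c : EReal) * φ s + (((1/2) * (⟪x, u⟫ - s) ^ 2 : ℝ) : EReal) ≤
      (c : EReal) * φ t + (((1/2) * (⟪x, u⟫ - t) ^ 2 : ℝ) : EReal))
    (p : H) (hp : p = x + ((s - ⟪x, u⟫) / c) • Uinv u) :
    ∀ y : H,
      φ ⟪p, u⟫ + (((1/2) * ⟪U (x - p), x - p⟫ : ℝ) : EReal) ≤
      φ ⟪y, u⟫ + (((1/2) * ⟪U (x - y), x - y⟫ : ℝ) : EReal) := by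
  intro y
  have hsymm : ∀ a b : H, ⟪U a, b⟫ = ⟪a, U b⟫ := hUsa.isSymmetric
  have hnonneg : ∀ a : H, 0 ≤ ⟪U a, a⟫ := fun a ↦
    (mul_nonneg hα.le (sq_nonneg ‖a‖)).trans (hUα a)
  have hv : Uinv u ≠ 0 := fun h ↦ hu (by rw [← hUinv₂ u, h, map_zero])
  have hc0 : 0 < c := by
    have h := hUα (Uinv u)
    rw [hUinv₂, real_inner_comm, ← hc] at h
    exact lt_of_lt_of_le (mul_pos hα (pow_pos (norm_pos_iff.mpr hv) 2)) h
  have hpu : ⟪p, u⟫ = s := by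
    rw [hp, inner_add_left, real_inner_smul_left, ← hc]
    field_simp
    ring
  have hquad : ⟪U (x - p), x - p⟫ = (⟪x, u⟫ - s) ^ 2 / c := by
    have hxp : x - p = ((⟪x, u⟫ - s) / c) • Uinv u := by
      rw [hp, sub_add_cancel_left, ← neg_smul, ← neg_div, neg_sub]
    rw [hxp, map_smul, hUinv₂, real_inner_smul_left, real_inner_smul_right, real_inner_comm (Uinv u) u,
      ← hc]
    field_simp
  have hcs : (⟪x, u⟫ - ⟪y, u⟫) ^ 2 / c ≤ ⟪U (x - y), x - y⟫ := by
    have h := inner_sq_div_le_of_symmetric_nonneg U hsymm hnonneg (Uinv u) (x - y)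
      (by rwa [hUinv₂, ← hc])
    rwa [hUinv₂, ← hc, inner_sub_left] at h
  rw [hpu, hquad, ← mul_div_assoc]
  refine (EReal.add_coe_div_le_of_mul_add_coe_le hc0 (hφbot s) (hφbot _) (hs ⟪y, u⟫)).trans ?_
  gcongr
  rw [mul_div_assoc]
  gcongr
end

section
/- Let H be a real Hilbert space, α > 0, U ∈ P_α(H), let u ∈ H with u ≠ 0, let ξ ∈ ℝ, and set H₀ := {y ∈ H : ⟪y,u⟫ ≤ ξ}. For x ∈ H define p := x if ⟪x,u⟫ ≤ ξ, and p := x + ((ξ − ⟪x,u⟫)/⟪U⁻¹u, u⟫)·U⁻¹u if ⟪x,u⟫ > ξ. Then p ∈ H₀, and for every y ∈ H₀ one has ⟪U(x−p), x−p⟫ ≤ ⟪U(x−y), x−y⟫, with equality only when y = p; that is, p is the unique projection of x onto H₀ in the norm ‖·‖_U induced by U. -/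
open RealInnerProductSpace

/-- The variational inequality at `p` implies that `p` is strictly `U`-closer to `x` than any
other point `y`. -/
theorem inner_le_and_eq_of_variational_inequality
    {H : Type*} [NormedAddCommGroup H] [InnerProductSpace ℝ H] [CompleteSpace H]
    {U : H →L[ℝ] H} (hUsa : IsSelfAdjoint U) (hUpos : ∀ z : H, z ≠ 0 → 0 < ⟪U z, z⟫)
    {x p y : H} (h : 0 ≤ ⟪U (x - p), p - y⟫) :
    ⟪U (x - p), x - p⟫ ≤ ⟪U (x - y), x - y⟫ ∧
      (⟪U (x - p), x - p⟫ = ⟪U (x - y), x - y⟫ → y = p) := by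
  have hsymm : ⟪U (p - y), x - p⟫ = ⟪U (x - p), p - y⟫ :=
    (hUsa.isSymmetric (p - y) (x - p)).trans (real_inner_comm _ _)
  have hexp : ⟪U (x - y), x - y⟫ =
      ⟪U (x - p), x - p⟫ + 2 * ⟪U (x - p), p - y⟫ + ⟪U (p - y), p - y⟫ := by
    rw [← sub_add_sub_cancel x p y, map_add, inner_add_left, inner_add_right, inner_add_right,
      hsymm]
    ring
  rcases eq_or_ne y p with rfl | hne
  · simp
  · have := hUpos (p - y) (sub_ne_zero.mpr hne.symm)
    exact ⟨by linarith, fun heq => absurd heq (by linarith)⟩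

/-- **Projection onto a half-space in the metric induced by `U`.**
With `H₀ = {y : ⟪y,u⟫ ≤ ξ}` and `p` given by the explicit formula, `p` is the unique
minimizer of `y ↦ ⟪U(x−y), x−y⟫` over `H₀`, i.e. the projection of `x` onto `H₀` in the
norm `‖·‖_U`. -/
theorem projection_halfspace_variable_metric
    {H : Type*} [NormedAddCommGroup H] [InnerProductSpace ℝ H] [CompleteSpace H]
    (α : ℝ) (hα : 0 < α)
    (U Uinv : H →L[ℝ] H) (hUsa : IsSelfAdjoint U)
    (hUα : ∀ x : H, ⟪U x, x⟫ ≥ α * ‖x‖ ^ 2)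
    (hUinv₁ : ∀ x : H, Uinv (U x) = x) (hUinv₂ : ∀ x : H, U (Uinv x) = x)
    (u : H) (hu : u ≠ 0) (ξ : ℝ)
    (H₀ : Set H) (hH₀ : H₀ = {y : H | ⟪y, u⟫ ≤ ξ})
    (x p : H)
    (hp : p = if ⟪x, u⟫ ≤ ξ then x else x + ((ξ - ⟪x, u⟫) / ⟪Uinv u, u⟫) • Uinv u) :
    p ∈ H₀ ∧ ∀ y ∈ H₀,
      ⟪U (x - p), x - p⟫ ≤ ⟪U (x - y), x - y⟫ ∧
      (⟪U (x - p), x - p⟫ = ⟪U (x - y), x - y⟫ → y = p) := by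
  subst hH₀
  have hUpos : ∀ z : H, z ≠ 0 → 0 < ⟪U z, z⟫ := fun z hz =>
    (by positivity : 0 < α * ‖z‖ ^ 2).trans_le (hUα z)
  suffices hvar : ⟪p, u⟫ ≤ ξ ∧ ∀ y : H, ⟪y, u⟫ ≤ ξ → 0 ≤ ⟪U (x - p), p - y⟫ from
    ⟨hvar.1, fun y hy => inner_le_and_eq_of_variational_inequality hUsa hUpos (hvar.2 y hy)⟩
  split_ifs at hp with hx
  · subst hp
    exact ⟨hx, fun y _ => by simp⟩
  · have hUinv_ne : Uinv u ≠ 0 := fun h => hu (by rw [← hUinv₂ u, h, map_zero])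
    have hden : 0 < ⟪Uinv u, u⟫ := by
      have := hUpos _ hUinv_ne
      rwa [hUinv₂, real_inner_comm] at this
    have hpu : ⟪p, u⟫ = ξ := by
      rw [hp, inner_add_left, real_inner_smul_left, div_mul_cancel₀ _ hden.ne']
      ring
    have hUp : U (x - p) = ((⟪x, u⟫ - ξ) / ⟪Uinv u, u⟫) • u := by
      rw [hp, sub_add_cancel_left, map_neg, map_smul, hUinv₂, ← neg_smul, ← neg_div, neg_sub]
    refine ⟨hpu.le, fun y hy => ?_⟩
    rw [hUp, real_inner_smul_left, real_inner_comm (p - y) u, inner_sub_left, hpu]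
    exact mul_nonneg (div_nonneg (by linarith) hden.le) (sub_nonneg.mpr hy)
end

section
/- Let H be a real Hilbert space, α > 0, γ ∈ ℝ, let A : H → H be a bounded self-adjoint linear operator with ⟪Ax, x⟫ ≥ 0 for all x, let u ∈ H, let U ∈ P_α(H), and define φ : H → ℝ by φ(x) = (1/2)⟪Ax, x⟫ + ⟪x, u⟫ + γ. Then for every x ∈ H there is a unique p ∈ H with U p + A p = U x − u (i.e. p = (Id + U⁻¹A)⁻¹(x − U⁻¹u)), and this p is the unique minimizer over H of y ↦ φ(y) + (1/2)⟪U(x−y), x−y⟫; that is, prox^U_φ(x) = (Id + U⁻¹A)⁻¹(x − U⁻¹u). -/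
open RealInnerProductSpace

/-- A coercive bounded operator on a real Hilbert space is bijective. -/
theorem ContinuousLinearMap.bijective_of_coercive
    {H : Type*} [NormedAddCommGroup H] [InnerProductSpace ℝ H] [CompleteSpace H]
    (T : H →L[ℝ] H) {α : ℝ} (hα : 0 < α) (hT : ∀ x : H, α * ‖x‖ ^ 2 ≤ ⟪T x, x⟫) :
    Function.Bijective T := by
  have hB : IsCoercive ((innerSL ℝ).comp T) := by
    refine ⟨α, hα, fun x => ?_⟩
    have h := hT x
    rw [pow_two, ← mul_assoc] at h
    simpa using h
  have hTB : ⇑T = hB.continuousLinearEquivOfBilin := by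
    funext x
    exact hB.unique_continuousLinearEquivOfBilin fun w => by simp
  rw [hTB]
  exact hB.continuousLinearEquivOfBilin.bijective

/-- For a self-adjoint operator, the quadratic form expands around any point. -/
theorem IsSelfAdjoint.inner_apply_add_self
    {H : Type*} [NormedAddCommGroup H] [InnerProductSpace ℝ H] [CompleteSpace H]
    {T : H →L[ℝ] H} (hT : IsSelfAdjoint T) (x y : H) :
    ⟪T (x + y), x + y⟫ = ⟪T x, x⟫ + 2 * ⟪T x, y⟫ + ⟪T y, y⟫ := by
  have h : ⟪T y, x⟫ = ⟪T x, y⟫ := by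
    rw [real_inner_comm]
    exact (hT.isSymmetric x y).symm
  simp only [map_add, inner_add_left, inner_add_right, h]
  ring

/-- **Proximity operator of a convex quadratic function in the metric induced by `U`.**
For `φ(x) = (1/2)⟪Ax,x⟫ + ⟪x,u⟫ + γ` with `A` positive self-adjoint and `U ∈ P_α(H)`:
for every `x` there is a unique `p` with `U p + A p = U x − u`, and this `p` is the
unique minimizer of `y ↦ φ(y) + (1/2)⟪U(x−y), x−y⟫`. -/
theorem prox_quadratic_variable_metric
    {H : Type*} [NormedAddCommGroup H] [InnerProductSpace ℝ H] [CompleteSpace H]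
    (α : ℝ) (hα : 0 < α) (γ : ℝ)
    (A : H →L[ℝ] H) (hAsa : IsSelfAdjoint A) (hApos : ∀ x : H, ⟪A x, x⟫ ≥ 0)
    (u : H)
    (U : H →L[ℝ] H) (hUsa : IsSelfAdjoint U)
    (hUα : ∀ x : H, ⟪U x, x⟫ ≥ α * ‖x‖ ^ 2)
    (φ : H → ℝ) (hφ : ∀ x : H, φ x = (1/2) * ⟪A x, x⟫ + ⟪x, u⟫ + γ) :
    ∀ x : H, (∃! p : H, U p + A p = U x - u) ∧
      ∀ p : H, U p + A p = U x - u →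
        ∀ y : H, y ≠ p →
          φ p + (1/2) * ⟪U (x - p), x - p⟫ < φ y + (1/2) * ⟪U (x - y), x - y⟫ := by
  intro x
  have hbij : Function.Bijective (U + A) :=
    (U + A).bijective_of_coercive hα fun z => by
      simp only [add_apply, inner_add_left]
      linarith [hUα z, hApos z]
  refine ⟨by simpa using hbij.existsUnique (U x - u), fun p hp y hy => ?_⟩
  obtain ⟨z, rfl⟩ : ∃ z, y = p + z := ⟨y - p, by abel⟩
  have hz : z ≠ 0 := by simpa using hy
  have hpos : 0 < α * ‖z‖ ^ 2 := by positivity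
  have hxz : x - (p + z) = (x - p) + -z := by abel
  have hcrit : ⟪U p, z⟫ + ⟪A p, z⟫ = ⟪U x, z⟫ - ⟪z, u⟫ := by
    rw [← inner_add_left, hp, inner_sub_left, real_inner_comm z u]
  rw [hφ, hφ, hxz, hAsa.inner_apply_add_self, hUsa.inner_apply_add_self (x - p)]
  simp only [map_neg, inner_neg_left, inner_neg_right, neg_neg, inner_add_left p z]
  have hsub : ⟪U (x - p), z⟫ = ⟪U x, z⟫ - ⟪U p, z⟫ := by
    rw [map_sub, inner_sub_left]
  linarith [hUα z, hApos z]
end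

section
/- Under the variable metric forward–backward setup, there exists x̄ ∈ Z such that x_n ⇀ x̄ (weakly) and Σ_{n} ‖Bx_n − Bx̄‖² < ∞. -/
open RealInnerProductSpace Filter Topology

/-- The product of two nonnegative summable real sequences is summable. -/
theorem summable_mul_of_nonneg {f g : ℕ → ℝ} (hf0 : ∀ n, 0 ≤ f n) (hg0 : ∀ n, 0 ≤ g n)
    (hf : Summable f) (hg : Summable g) : Summable fun n => f n * g n := by
  refine Summable.of_nonneg_of_le (fun n => mul_nonneg (hf0 n) (hg0 n)) (fun n => ?_)
    (hg.mul_left (∑' k, f k))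
  exact mul_le_mul_of_nonneg_right (hf.le_tsum n fun k _ => hf0 k) (hg0 n)

/-- Deterministic Robbins–Siegmund lemma. -/
theorem exists_tendsto_and_summable_of_quasi_decreasing {S r τ e : ℕ → ℝ}
    (hS : ∀ n, 0 ≤ S n) (hr : ∀ n, 0 ≤ r n) (hτ : ∀ n, 0 ≤ τ n) (he : ∀ n, 0 ≤ e n)
    (hτs : Summable τ) (hes : Summable e)
    (h : ∀ n, S (n + 1) + r n ≤ (1 + τ n) * S n + e n) :
    (∃ l, Tendsto S atTop (𝓝 l)) ∧ Summable r := by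
  have hbound : ∀ n, S n ≤ Real.exp (∑ k ∈ Finset.range n, τ k) *
      (S 0 + ∑ k ∈ Finset.range n, e k) := by
    intro n
    induction n with
    | zero => simp
    | succ n ih =>
      rw [Finset.sum_range_succ, Finset.sum_range_succ, Real.exp_add]
      have h1 : 1 + τ n ≤ Real.exp (τ n) := by linarith [Real.add_one_le_exp (τ n)]
      have h2 : 1 ≤ Real.exp (∑ k ∈ Finset.range n, τ k) :=
        Real.one_le_exp (Finset.sum_nonneg fun k _ => hτ k)
      have h3 : 1 ≤ Real.exp (τ n) := Real.one_le_exp (hτ n)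
      have h4 : (1 + τ n) * S n ≤ Real.exp (τ n) * (Real.exp (∑ k ∈ Finset.range n, τ k) *
          (S 0 + ∑ k ∈ Finset.range n, e k)) :=
        mul_le_mul h1 ih (hS n) (Real.exp_pos _).le
      have h5 : e n ≤ Real.exp (∑ k ∈ Finset.range n, τ k) * Real.exp (τ n) * e n :=
        le_mul_of_one_le_left (he n) (one_le_mul_of_one_le_of_one_le h2 h3)
      linarith [h n, hr n]
  set M := Real.exp (∑' k, τ k) * (S 0 + ∑' k, e k) with hM
  have hSM : ∀ n, S n ≤ M := by
    intro n
    refine (hbound n).trans ?_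
    have h1 := hτs.sum_le_tsum (Finset.range n) fun k _ => hτ k
    have h2 := hes.sum_le_tsum (Finset.range n) fun k _ => he k
    have h3 : 0 ≤ S 0 + ∑ k ∈ Finset.range n, e k :=
      add_nonneg (hS 0) (Finset.sum_nonneg fun k _ => he k)
    exact mul_le_mul (Real.exp_le_exp.2 h1) (by linarith) h3 (Real.exp_pos _).le
  set f : ℕ → ℝ := fun n => τ n * M + e n with hf
  have hfs : Summable f := (hτs.mul_right M).add hes
  have hf0 : ∀ n, 0 ≤ f n := fun n =>
    add_nonneg (mul_nonneg (hτ n) ((hS 0).trans (hSM 0))) (he n)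
  have hstep : ∀ n, S (n + 1) + r n ≤ S n + f n := by
    intro n
    have := mul_le_mul_of_nonneg_left (hSM n) (hτ n)
    simp only [hf]
    linarith [h n]
  set T : ℕ → ℝ := fun n => S n + ∑ k ∈ Finset.range n, r k - ∑ k ∈ Finset.range n, f k with hT
  have hTanti : Antitone T := by
    refine antitone_nat_of_succ_le fun n => ?_
    simp only [hT, Finset.sum_range_succ]
    linarith [hstep n]
  have hfle : ∀ n, ∑ k ∈ Finset.range n, f k ≤ ∑' k, f k := fun n =>
    hfs.sum_le_tsum _ fun k _ => hf0 k
  have hrs : Summable r := by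
    refine summable_of_sum_range_le (c := S 0 + ∑' k, f k) hr fun n => ?_
    have h1 := hTanti (Nat.zero_le n)
    simp only [hT, Finset.range_zero, Finset.sum_empty] at h1
    linarith [hS n, hfle n]
  refine ⟨?_, hrs⟩
  have hTb : BddBelow (Set.range T) := by
    refine ⟨-∑' k, f k, ?_⟩
    rintro _ ⟨n, rfl⟩
    have := Finset.sum_nonneg (s := Finset.range n) fun k _ => hr k
    simp only [hT]
    linarith [hS n, hfle n]
  have hTl := tendsto_atTop_ciInf hTanti hTb
  refine ⟨_, ((hTl.sub hrs.hasSum.tendsto_sum_nat).add hfs.hasSum.tendsto_sum_nat).congr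
    fun n => ?_⟩
  simp only [hT]
  ring

section Metric

variable {H : Type*} [NormedAddCommGroup H] [InnerProductSpace ℝ H]

/-- A bounded coercive operator on a Hilbert space has a bounded inverse (Lax–Milgram). -/
theorem exists_inverse_of_coercive [CompleteSpace H] {U : H →L[ℝ] H} {α : ℝ} (hα : 0 < α)
    (hU : ∀ x, α * ‖x‖ ^ 2 ≤ ⟪U x, x⟫) :
    ∃ W : H →L[ℝ] H, (∀ x, U (W x) = x) ∧ ∀ x, W (U x) = x := by
  let b : H →L[ℝ] H →L[ℝ] ℝ := (innerSL ℝ).comp U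
  have hb : IsCoercive b := ⟨α, hα, fun x => by
    have := hU x
    simp only [b, ContinuousLinearMap.comp_apply, innerSL_apply_apply]
    nlinarith⟩
  let E := hb.continuousLinearEquivOfBilin
  have hE : ∀ x, E x = U x := fun x => ext_inner_right ℝ fun w => by
    rw [hb.continuousLinearEquivOfBilin_apply]
    simp [b]
  refine ⟨E.symm, fun x => ?_, fun x => ?_⟩
  · rw [← hE]; simp
  · rw [← hE]; simp

/-- `W` is a two-sided inverse of the self-adjoint operator `U`, where `α ≤ U ≤ m`. -/
structure IsMetricInverse (α m : ℝ) (U W : H →L[ℝ] H) : Prop where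
  symm : ∀ x y, ⟪U x, y⟫ = ⟪x, U y⟫
  lower : ∀ x, α * ‖x‖ ^ 2 ≤ ⟪U x, x⟫
  upper : ∀ x, ⟪U x, x⟫ ≤ m * ‖x‖ ^ 2
  right_inv : ∀ x, U (W x) = x
  left_inv : ∀ x, W (U x) = x

namespace IsMetricInverse

variable {α m : ℝ} {U W : H →L[ℝ] H}

theorem inv_symm (h : IsMetricInverse α m U W) (x y : H) : ⟪W x, y⟫ = ⟪x, W y⟫ := by
  have := h.symm (W x) (W y)
  rw [h.right_inv, h.right_inv] at this
  exact this.symm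

theorem two_mul_inner_sub_le (h : IsMetricInverse α m U W) (hα : 0 < α) (z w : H) :
    2 * ⟪z, w⟫ - ⟪U w, w⟫ ≤ ⟪W z, z⟫ := by
  have h1 : 0 ≤ ⟪U (W z - w), W z - w⟫ := (by positivity : 0 ≤ α * ‖W z - w‖ ^ 2).trans (h.lower _)
  have h2 : ⟪U w, W z⟫ = ⟪w, z⟫ := by rw [h.symm, h.right_inv]
  rw [map_sub, h.right_inv, inner_sub_left, inner_sub_right, inner_sub_right, h2,
    real_inner_comm z w, real_inner_comm (W z) z] at h1
  linarith

theorem sq_norm_le (h : IsMetricInverse α m U W) (hα : 0 < α) (hm : 0 < m) (z : H) :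
    ‖z‖ ^ 2 ≤ m * ⟪W z, z⟫ := by
  have h1 := h.two_mul_inner_sub_le hα z (m⁻¹ • z)
  rw [map_smul, real_inner_smul_left, real_inner_smul_right, real_inner_smul_right,
    real_inner_self_eq_norm_sq] at h1
  have h2 := h.upper z
  have h3 : m * (2 * (m⁻¹ * ‖z‖ ^ 2) - m⁻¹ * (m⁻¹ * ⟪U z, z⟫)) = 2 * ‖z‖ ^ 2 - m⁻¹ * ⟪U z, z⟫ := by
    field_simp
  have h4 : m⁻¹ * ⟪U z, z⟫ ≤ m⁻¹ * (m * ‖z‖ ^ 2) := by gcongr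
  rw [inv_mul_cancel_left₀ hm.ne'] at h4
  have h5 := mul_le_mul_of_nonneg_left h1 hm.le
  linarith

theorem inner_nonneg (h : IsMetricInverse α m U W) (hα : 0 < α) (z : H) :
    0 ≤ ⟪W z, z⟫ := by
  simpa using h.two_mul_inner_sub_le hα z 0

theorem norm_inv_le (h : IsMetricInverse α m U W) (z : H) :
    α * ‖W z‖ ≤ ‖z‖ := by
  have h1 := h.lower (W z)
  rw [h.right_inv] at h1
  have h2 := real_inner_le_norm z (W z)
  rcases (norm_nonneg (W z)).eq_or_lt with h0 | h0
  · rw [← h0]; simp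
  · refine le_of_mul_le_mul_right ?_ h0
    nlinarith

theorem inner_le (h : IsMetricInverse α m U W) (hα : 0 < α) (z : H) :
    α * ⟪W z, z⟫ ≤ ‖z‖ ^ 2 := by
  have h1 := h.norm_inv_le z
  have h2 := mul_le_mul_of_nonneg_left (real_inner_le_norm (W z) z) hα.le
  nlinarith [norm_nonneg z]

/-- Order reversal: `U ≤ (1 + η) U'` implies `U'⁻¹ ≤ (1 + η) U⁻¹`. -/
theorem inner_le_of_le {U' W' : H →L[ℝ] H} (h : IsMetricInverse α m U W)
    (h' : IsMetricInverse α m U' W') (hα : 0 < α) {η : ℝ} (hη : 0 ≤ η)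
    (hle : ∀ x, ⟪U x, x⟫ ≤ (1 + η) * ⟪U' x, x⟫) (z : H) :
    ⟪W' z, z⟫ ≤ (1 + η) * ⟪W z, z⟫ := by
  have hpos : 0 < 1 + η := by linarith
  have h1 := h.two_mul_inner_sub_le hα z ((1 + η)⁻¹ • W' z)
  have h2 := hle (W' z)
  rw [h'.right_inv] at h2
  rw [map_smul, real_inner_smul_left, real_inner_smul_right, real_inner_smul_right,
    real_inner_comm (W' z) z] at h1
  rw [real_inner_comm (W' z) z] at h2
  have h3 : (1 + η)⁻¹ * ((1 + η)⁻¹ * ⟪U (W' z), W' z⟫) ≤ (1 + η)⁻¹ * ⟪W' z, z⟫ := by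
    gcongr
    rw [inv_mul_le_iff₀ hpos]
    exact h2
  have h4 : (1 + η)⁻¹ * ⟪W' z, z⟫ ≤ ⟪W z, z⟫ := by linarith
  rwa [inv_mul_le_iff₀ hpos] at h4

theorem inner_add (h : IsMetricInverse α m U W) (u v : H) :
    ⟪W (u + v), u + v⟫ = ⟪W u, u⟫ + 2 * ⟪W u, v⟫ + ⟪W v, v⟫ := by
  rw [map_add, inner_add_left, inner_add_right, inner_add_right, h.inv_symm v u,
    real_inner_comm (W u) v]
  ring

/-- Convexity of the quadratic form of the inverse. -/
theorem inner_convex (h : IsMetricInverse α m U W) (hα : 0 < α) {t : ℝ} (ht0 : 0 ≤ t)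
    (ht1 : t ≤ 1) (u v : H) :
    ⟪W ((1 - t) • u + t • v), (1 - t) • u + t • v⟫ ≤ (1 - t) * ⟪W u, u⟫ + t * ⟪W v, v⟫ := by
  have h1 := h.inner_nonneg hα (u + (-1 : ℝ) • v)
  rw [h.inner_add] at h1 ⊢
  simp only [map_smul, real_inner_smul_left, real_inner_smul_right] at h1 ⊢
  nlinarith [mul_nonneg (mul_nonneg ht0 (sub_nonneg.2 ht1)) h1]

/-- Perturbation of the quadratic form by a small vector. -/
theorem inner_add_smul_le (h : IsMetricInverse α m U W) (hα : 0 < α) (hm : 0 < m) {t K : ℝ}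
    (ht0 : 0 ≤ t) (ht1 : t ≤ 1) (u v : H) (hv : ‖v‖ ≤ K) :
    ⟪W (u + t • v), u + t • v⟫ ≤
      (1 + m / α * ‖v‖) * ⟪W u, u⟫ + (1 + K) / α * ‖v‖ := by
  rw [h.inner_add]
  simp only [map_smul, real_inner_smul_left, real_inner_smul_right]
  have h1 := real_inner_le_norm (W u) v
  have h2 := h.norm_inv_le u
  have h3 := h.inner_le hα v
  have h4 := h.inner_nonneg hα v
  have h5 := h.sq_norm_le hα hm u
  have h6 : α * (2 * (t * ⟪W u, v⟫)) ≤ ‖v‖ * (1 + m * ⟪W u, u⟫) := by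
    have h7 : α * ⟪W u, v⟫ ≤ ‖u‖ * ‖v‖ := by
      nlinarith [norm_nonneg v]
    have h8 : t * (α * ⟪W u, v⟫) ≤ ‖u‖ * ‖v‖ := by
      have : 0 ≤ ‖u‖ * ‖v‖ := by positivity
      nlinarith
    have h9 : 2 * ‖u‖ ≤ 1 + m * ⟪W u, u⟫ := by nlinarith [sq_nonneg (‖u‖ - 1)]
    nlinarith [norm_nonneg v]
  have h7 : α * (t * (t * ⟪W v, v⟫)) ≤ ‖v‖ * K := by
    have : t * t ≤ 1 := by nlinarith
    have : t * t * (α * ⟪W v, v⟫) ≤ ‖v‖ ^ 2 := by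
      have := mul_nonneg hα.le h4
      nlinarith
    nlinarith [norm_nonneg v]
  refine le_of_mul_le_mul_left ?_ hα
  have h8 : α * ((1 + m / α * ‖v‖) * ⟪W u, u⟫ + (1 + K) / α * ‖v‖) =
      α * ⟪W u, u⟫ + m * ‖v‖ * ⟪W u, u⟫ + (1 + K) * ‖v‖ := by
    field_simp
  rw [h8]
  linarith

/-- The basic descent inequality of one forward–backward step. -/
theorem forward_backward_descent (h : IsMetricInverse α m U W)
    {β ε γ : ℝ} (hε : 0 < ε) (hγ : ε ≤ γ) (hγm : γ * m ≤ 2 * β - ε) {x p z u d c b : H}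
    (hmon : 0 ≤ ⟪p - z, u + c⟫) (hstep : x - p = γ • U (u + (c + d) + b))
    (hd : β * ‖d‖ ^ 2 ≤ ⟪x - z, d⟫) :
    ⟪W (p - z), p - z⟫ + (ε ^ 2 * ‖d‖ ^ 2 + ⟪W (x - p - γ • U d), x - p - γ • U d⟫) ≤
      ⟪W (x - z), x - z⟫ + 2 * (γ * (‖b‖ * ‖p - z‖)) := by
  have hW : W (x - p) = γ • (u + (c + d) + b) := by rw [hstep, map_smul, h.left_inv]
  have e1 : ⟪W (x - z), x - z⟫ = ⟪W (x - p), x - p⟫ + 2 * ⟪W (x - p), p - z⟫ +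
      ⟪W (p - z), p - z⟫ := by
    rw [← h.inner_add]; simp
  have e2 : ⟪W (x - p), p - z⟫ = γ * (⟪p - z, u + c⟫ + ⟪p - z, d⟫ + ⟪p - z, b⟫) := by
    rw [hW, real_inner_smul_left, real_inner_comm, ← inner_add_right, ← inner_add_right]
    congr 2
    abel
  have e3 : ⟪W (x - p - γ • U d), x - p - γ • U d⟫ =
      ⟪W (x - p), x - p⟫ - 2 * γ * ⟪x - p, d⟫ + γ ^ 2 * ⟪U d, d⟫ := by
    rw [sub_eq_add_neg (x - p), ← neg_smul, h.inner_add, h.inv_symm (x - p) (-γ • U d)]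
    simp only [map_smul, real_inner_smul_left, real_inner_smul_right, h.left_inv,
      real_inner_comm (U d) d]
    ring
  have e4 : ⟪p - z, d⟫ = ⟪x - z, d⟫ - ⟪x - p, d⟫ := by
    rw [← inner_sub_left]; congr 1; abel
  have hγ0 : 0 < γ := hε.trans_le hγ
  have h1 : -(‖b‖ * ‖p - z‖) ≤ ⟪p - z, b⟫ := by
    have := abs_le.1 (abs_real_inner_le_norm (p - z) b)
    linarith [this.1, mul_comm ‖p - z‖ ‖b‖]
  have h2 := mul_le_mul_of_nonneg_left h1 hγ0.le
  have h3 := mul_nonneg hγ0.le hmon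
  have h4 := mul_le_mul_of_nonneg_left hd hγ0.le
  have h5 := mul_le_mul_of_nonneg_left (h.upper d) (sq_nonneg γ)
  have h6 : γ ^ 2 * (m * ‖d‖ ^ 2) + ε ^ 2 * ‖d‖ ^ 2 ≤ 2 * (γ * (β * ‖d‖ ^ 2)) := by
    have : γ ^ 2 * m + ε ^ 2 ≤ 2 * γ * β := by nlinarith
    nlinarith [sq_nonneg ‖d‖]
  rw [e1, e2, e3, e4]
  linarith

/-- Absorbing the error term of the descent inequality. -/
theorem descent_absorb_error (h : IsMetricInverse α m U W) (hα : 0 < α) (hm : 0 < m)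
    {γ G K R s : ℝ} (hγ0 : 0 ≤ γ) (hγG : γ ≤ G) {v b : H} (hb : ‖b‖ ≤ K) (hR : 0 ≤ R)
    (hle : ⟪W v, v⟫ + R ≤ s + 2 * (γ * (‖b‖ * ‖v‖))) :
    ⟪W v, v⟫ + R ≤ (1 + 2 * m * G * ‖b‖) * s + (G + 4 * m ^ 2 * G ^ 3 * K ^ 2) * ‖b‖ := by
  have h1 := h.sq_norm_le hα hm v
  have hG : 0 ≤ G := hγ0.trans hγG
  have hc : γ * ‖b‖ ≤ G * ‖b‖ := by gcongr
  set c := G * ‖b‖ with hc_def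
  have hc0 : 0 ≤ c := by positivity
  have hle' : ⟪W v, v⟫ + R ≤ s + 2 * (c * ‖v‖) := by
    nlinarith [norm_nonneg v]
  have h2 : m * (2 * (c * ‖v‖)) ≤ m * (⟪W v, v⟫ / 2 + 2 * m * c ^ 2) := by
    nlinarith [sq_nonneg (‖v‖ - 2 * m * c)]
  have h3 := le_of_mul_le_mul_left h2 hm
  have h4 : ⟪W v, v⟫ ≤ 2 * s + 4 * m * c ^ 2 := by linarith
  have h5 : 2 * ‖v‖ ≤ 1 + m * (2 * s + 4 * m * c ^ 2) := by
    nlinarith [sq_nonneg (‖v‖ - 1)]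
  have h6 : c ^ 2 ≤ G ^ 2 * K ^ 2 := by
    rw [hc_def, mul_pow]; gcongr
  have h7 : c * (4 * m ^ 2 * c ^ 2) ≤ c * (4 * m ^ 2 * (G ^ 2 * K ^ 2)) := by gcongr
  have h8 := mul_le_mul_of_nonneg_left h5 hc0
  have h9 : (1 + 2 * m * G * ‖b‖) * s + (G + 4 * m ^ 2 * G ^ 3 * K ^ 2) * ‖b‖ =
      s + c * (2 * m * s) + c + c * (4 * m ^ 2 * (G ^ 2 * K ^ 2)) := by
    rw [hc_def]; ring
  rw [h9]
  linarith

end IsMetricInverse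

/-- A symmetric operator `T` with `0 ≤ T ≤ k` satisfies `‖T z‖² ≤ k ⟪T z, z⟫`. -/
theorem sq_norm_apply_le_of_le {T : H →L[ℝ] H} {k : ℝ} (hk : 0 < k)
    (hsymm : ∀ x y, ⟪T x, y⟫ = ⟪x, T y⟫) (h0 : ∀ x, 0 ≤ ⟪T x, x⟫)
    (hle : ∀ x, ⟪T x, x⟫ ≤ k * ‖x‖ ^ 2) (z : H) : ‖T z‖ ^ 2 ≤ k * ⟪T z, z⟫ := by
  have h1 := h0 (k • z - T z)
  have h2 := hle (T z)
  have h3 := hsymm (T z) z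
  simp only [map_sub, map_smul, inner_sub_left, inner_sub_right, real_inner_smul_left,
    real_inner_smul_right] at h1
  rw [h3, real_inner_self_eq_norm_sq] at h1
  refine le_of_mul_le_mul_left ?_ hk
  linarith

/-- Bounded symmetric operators that are nonincreasing up to summable relative errors
converge pointwise. -/
theorem exists_tendsto_of_quasi_antitone [CompleteSpace H] {W : ℕ → H →L[ℝ] H} {η : ℕ → ℝ} {k : ℝ}
    (hk : 0 < k) (hη0 : ∀ n, 0 ≤ η n) (hη : Summable η)
    (hsymm : ∀ n x y, ⟪W n x, y⟫ = ⟪x, W n y⟫) (h0 : ∀ n x, 0 ≤ ⟪W n x, x⟫)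
    (hle : ∀ n x, ⟪W n x, x⟫ ≤ k * ‖x‖ ^ 2)
    (hmono : ∀ n x, ⟪W (n + 1) x, x⟫ ≤ (1 + η n) * ⟪W n x, x⟫) (z : H) :
    ∃ v, Tendsto (fun n => W n z) atTop (𝓝 v) := by
  set P : ℕ → ℝ := fun n => ∏ i ∈ Finset.range n, (1 + η i) with hP
  have hP1 : ∀ n, 1 ≤ P n := fun n => by
    rw [← Finset.prod_const_one (s := Finset.range n)]
    refine Finset.prod_le_prod (fun _ _ => zero_le_one) fun i _ => ?_
    linarith [hη0 i]
  have hP0 : ∀ n, 0 < P n := fun n => one_pos.trans_le (hP1 n)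
  have hPs : ∀ n, P (n + 1) = P n * (1 + η n) := fun n => Finset.prod_range_succ _ _
  obtain ⟨L, hL⟩ : ∃ L, Tendsto P atTop (𝓝 L) := by
    have hmonoP : Monotone P := monotone_nat_of_le_succ fun n => by
      rw [hPs]; nlinarith [hP0 n, hη0 n]
    refine ⟨_, tendsto_atTop_ciSup hmonoP ⟨Real.exp (∑' i, η i), ?_⟩⟩
    rintro _ ⟨n, rfl⟩
    calc P n ≤ ∏ i ∈ Finset.range n, Real.exp (η i) := by
          refine Finset.prod_le_prod (fun i _ => by linarith [hη0 i]) fun i _ => ?_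
          linarith [Real.add_one_le_exp (η i)]
      _ = Real.exp (∑ i ∈ Finset.range n, η i) := (Real.exp_sum _ _).symm
      _ ≤ _ := Real.exp_le_exp.2 (hη.sum_le_tsum _ fun i _ => hη0 i)
  set V : ℕ → H →L[ℝ] H := fun n => (P n)⁻¹ • W n with hV
  have hVi : ∀ n x y, ⟪V n x, y⟫ = (P n)⁻¹ * ⟪W n x, y⟫ := fun n x y => by
    simp [hV, real_inner_smul_left]
  have hVanti : ∀ x, Antitone fun n => ⟪V n x, x⟫ := fun x => by
    refine antitone_nat_of_succ_le fun n => ?_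
    rw [hVi, hVi, hPs, mul_inv, mul_assoc]
    have : 0 < 1 + η n := by linarith [hη0 n]
    refine mul_le_mul_of_nonneg_left ?_ (inv_pos.2 (hP0 n)).le
    rw [inv_mul_le_iff₀ this]
    exact hmono n x
  have hV0 : ∀ n x, 0 ≤ ⟪V n x, x⟫ := fun n x => by
    rw [hVi]; exact mul_nonneg (inv_pos.2 (hP0 n)).le (h0 n x)
  have hVle : ∀ n x, ⟪V n x, x⟫ ≤ k * ‖x‖ ^ 2 := fun n x => by
    rw [hVi]
    exact (mul_le_of_le_one_left (h0 n x) (inv_le_one_of_one_le₀ (hP1 n))).trans (hle n x)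
  have hcauchyReal : CauchySeq fun n => ⟪V n z, z⟫ :=
    (tendsto_atTop_ciInf (hVanti z) ⟨0, by rintro _ ⟨n, rfl⟩; exact hV0 n z⟩).cauchySeq
  have hdiff : ∀ n N, N ≤ n → ‖V N z - V n z‖ ^ 2 ≤ k * (⟪V N z, z⟫ - ⟪V n z, z⟫) := by
    intro n N hn
    have := sq_norm_apply_le_of_le (T := V N - V n) hk ?_ ?_ ?_ z
    · simpa [inner_sub_left] using this
    · intro x y
      simp only [sub_apply, inner_sub_left, inner_sub_right, hVi, hsymm]
      rw [real_inner_comm (V N y) x, real_inner_comm (V n y) x, hVi, hVi,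
        real_inner_comm x (W N y), real_inner_comm x (W n y)]
    · intro x
      simp only [sub_apply, inner_sub_left]
      linarith [hVanti x hn]
    · intro x
      simp only [sub_apply, inner_sub_left]
      linarith [hV0 n x, hVle N x]
  have hcauchy : CauchySeq fun n => V n z := by
    rw [Metric.cauchySeq_iff'] at hcauchyReal ⊢
    intro δ hδ
    obtain ⟨N, hN⟩ := hcauchyReal (δ ^ 2 / k) (by positivity)
    refine ⟨N, fun n hn => ?_⟩
    have h1 := hN n hn
    rw [Real.dist_eq, abs_sub_comm] at h1
    have h2 := (le_abs_self _).trans_lt h1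
    rw [lt_div_iff₀ hk] at h2
    rw [dist_comm, dist_eq_norm]
    exact lt_of_pow_lt_pow_left₀ 2 hδ.le (by linarith [hdiff n N hn])
  obtain ⟨v, hv⟩ := cauchySeq_tendsto_of_complete hcauchy
  refine ⟨L • v, (hL.smul hv).congr fun n => ?_⟩
  simp [hV, smul_smul, (hP0 n).ne']

/-- The inner product of a bounded weakly convergent family with a strongly convergent one
converges. -/
theorem tendsto_inner_of_weak_of_strong {ι : Type*} {l : Filter ι} {x v : ι → H} {x₀ v₀ : H}
    {M : ℝ} (hM : ∀ i, ‖x i‖ ≤ M) (hx : ∀ w, Tendsto (fun i => ⟪x i, w⟫) l (𝓝 ⟪x₀, w⟫))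
    (hv : Tendsto v l (𝓝 v₀)) : Tendsto (fun i => ⟪x i, v i⟫) l (𝓝 ⟪x₀, v₀⟫) := by
  have h1 : Tendsto (fun i => ⟪x i, v i - v₀⟫) l (𝓝 0) := by
    have h2 : Tendsto (fun i => M * ‖v i - v₀‖) l (𝓝 0) := by
      simpa using (tendsto_iff_norm_sub_tendsto_zero.1 hv).const_mul M
    refine squeeze_zero_norm (fun i => ?_) h2
    exact (norm_inner_le_norm _ _).trans (mul_le_mul_of_nonneg_right (hM i) (norm_nonneg _))
  have h2 := h1.add (hx v₀)
  rw [zero_add] at h2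
  refine h2.congr fun i => ?_
  rw [inner_sub_right]; ring

/-- Bounded families in a Hilbert space converge weakly along every ultrafilter. -/
theorem exists_weak_limit_of_bounded [CompleteSpace H] {ι : Type*} {x : ι → H} {M : ℝ}
    (hM : ∀ i, ‖x i‖ ≤ M) (F : Ultrafilter ι) :
    ∃ x₀ : H, ∀ w, Tendsto (fun i => ⟪x i, w⟫) F (𝓝 ⟪x₀, w⟫) := by
  let f : ι → WeakDual ℝ H := fun i => StrongDual.toWeakDual (InnerProductSpace.toDual ℝ H (x i))
  have hcomp := WeakDual.isCompact_closedBall (𝕜 := ℝ) (E := H) 0 M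
  obtain ⟨g, -, hg⟩ := hcomp.ultrafilter_le_nhds (F.map f) (by
    rw [le_principal_iff]
    refine Filter.mem_of_superset (Filter.univ_mem' (f := (F : Filter ι)) fun i => ?_) subset_rfl
    simp [f, hM i])
  refine ⟨(InnerProductSpace.toDual ℝ H).symm (WeakDual.toStrongDual g), fun w => ?_⟩
  have h1 : Tendsto f F (𝓝 g) := hg
  have h2 := ((WeakDual.eval_continuous w).tendsto g).comp h1
  simpa [f, Function.comp_def] using h2

end Metric

/-- **Variable metric forward–backward splitting: weak convergence.**
Under the variable metric forward–backward setup, the iterates `x n` converge weakly to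
some zero `xb` of `A + B`, and `∑ ‖B (x n) − B xb‖²` converges. -/
theorem variable_metric_forward_backward_weak
    {H : Type*} [NormedAddCommGroup H] [InnerProductSpace ℝ H] [CompleteSpace H]
    (A : H → Set H)
    (hAmono : ∀ x y u v : H, u ∈ A x → v ∈ A y → ⟪x - y, u - v⟫ ≥ 0)
    (hAmax : ∀ y v : H, (∀ x u : H, u ∈ A x → ⟪x - y, u - v⟫ ≥ 0) → v ∈ A y)
    (β : ℝ) (hβ : 0 < β) (B : H → H)
    (hB : ∀ x y : H, ⟪x - y, B x - B y⟫ ≥ β * ‖B x - B y‖ ^ 2)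
    (η : ℕ → ℝ) (hη0 : ∀ n, 0 ≤ η n) (hηsum : Summable η)
    (α : ℝ) (hα : 0 < α)
    (U : ℕ → H →L[ℝ] H) (hUsa : ∀ n, IsSelfAdjoint (U n))
    (hUα : ∀ n (x : H), ⟪U n x, x⟫ ≥ α * ‖x‖ ^ 2)
    (μ : ℝ) (hμ : IsLUB (Set.range fun n => ‖U n‖) μ)
    (hUmono : ∀ n (x : H), (1 + η n) * ⟪U (n + 1) x, x⟫ ≥ ⟪U n x, x⟫)
    (ε : ℝ) (hε : ε ∈ Set.Ioc 0 (min 1 (2 * β / (μ + 1))))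
    (lam : ℕ → ℝ) (hlam : ∀ n, lam n ∈ Set.Icc ε 1)
    (gam : ℕ → ℝ) (hgam : ∀ n, gam n ∈ Set.Icc ε ((2 * β - ε) / μ))
    (a b : ℕ → H) (ha : Summable fun n => ‖a n‖) (hb : Summable fun n => ‖b n‖)
    (Z : Set H) (hZdef : Z = {x : H | -B x ∈ A x}) (hZ : Z.Nonempty)
    (x y p : ℕ → H)
    (hy : ∀ n, y n = x n - gam n • U n (B (x n) + b n))
    (hp : ∀ n, y n - p n ∈ (fun u => gam n • U n u) '' A (p n))
    (hx : ∀ n, x (n + 1) = x n + lam n • (p n + a n - x n)) :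
    ∃ xb ∈ Z,
      (∀ w : H, Tendsto (fun n => ⟪x n, w⟫) atTop (𝓝 ⟪xb, w⟫)) ∧
      Summable (fun n => ‖B (x n) - B xb‖ ^ 2) := by
  obtain ⟨hε0, -⟩ := hε
  subst hZdef
  have hUm : ∀ n, ‖U n‖ ≤ μ := fun n => hμ.1 ⟨n, rfl⟩
  have hμ0 : 0 < μ := by
    rcases ((norm_nonneg _).trans (hUm 0)).eq_or_lt with h | h
    · have := (hgam 0).1.trans (hgam 0).2
      rw [← h, div_zero] at this
      linarith
    · exact h
  choose W hW1 hW2 using fun n => exists_inverse_of_coercive hα (hUα n)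
  have hW : ∀ n, IsMetricInverse α μ (U n) (W n) := fun n =>
    { symm := fun x y => (hUsa n).isSymmetric x y
      lower := hUα n
      upper := fun x => by
        have h1 := real_inner_le_norm (U n x) x
        have h2 := (U n).le_of_opNorm_le (hUm n) x
        nlinarith [norm_nonneg x]
      right_inv := hW1 n
      left_inv := hW2 n }
  have hWmono : ∀ n z, ⟪W (n + 1) z, z⟫ ≤ (1 + η n) * ⟪W n z, z⟫ := fun n =>
    (hW n).inner_le_of_le (hW (n + 1)) hα (hη0 n) (hUmono n)
  have hγ0 : ∀ n, 0 < gam n := fun n => hε0.trans_le (hgam n).1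
  choose u hu hyp using hp
  simp only at hyp
  have hxp : ∀ n, x n - p n = gam n • U n (u n + B (x n) + b n) := fun n => by
    have h1 := hyp n
    rw [hy] at h1
    have h2 : x n - p n = gam n • U n (u n) + gam n • U n (B (x n) + b n) := by
      rw [h1]; abel
    rw [h2, ← smul_add, ← map_add, add_assoc]
  -- Quasi-Fejér monotonicity
  have key : ∀ z, -B z ∈ A z →
      (∃ l, Tendsto (fun n => ⟪W n (x n - z), x n - z⟫) atTop (𝓝 l)) ∧
      Summable fun n => ε * (ε ^ 2 * ‖B (x n) - B z‖ ^ 2 +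
        ⟪W n (x n - p n - gam n • U n (B (x n) - B z)),
          x n - p n - gam n • U n (B (x n) - B z)⟫) := by
    intro z hz
    set G := (2 * β - ε) / μ with hG
    have hG0 : 0 < G := (hγ0 0).trans_le (hgam 0).2
    set Ka := ∑' n, ‖a n‖
    set Kb := ∑' n, ‖b n‖
    have hKa : ∀ n, ‖a n‖ ≤ Ka := fun n => ha.le_tsum n fun _ _ => norm_nonneg _
    have hKb : ∀ n, ‖b n‖ ≤ Kb := fun n => hb.le_tsum n fun _ _ => norm_nonneg _
    have hKa0 : 0 ≤ Ka := (norm_nonneg _).trans (hKa 0)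
    have hKb0 : 0 ≤ Kb := (norm_nonneg _).trans (hKb 0)
    set c : ℕ → ℝ := fun n => 2 * μ * G * ‖b n‖
    set e : ℕ → ℝ := fun n => (G + 4 * μ ^ 2 * G ^ 3 * Kb ^ 2) * ‖b n‖
    set c' : ℕ → ℝ := fun n => μ / α * ‖a n‖
    set e' : ℕ → ℝ := fun n => (1 + Ka) / α * ‖a n‖
    have hc0 : ∀ n, 0 ≤ c n := fun n => by positivity
    have he0 : ∀ n, 0 ≤ e n := fun n => by positivity
    have hc0' : ∀ n, 0 ≤ c' n := fun n => by positivity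
    have he0' : ∀ n, 0 ≤ e' n := fun n => by positivity
    have hcs : Summable c := hb.mul_left _
    have hes : Summable e := hb.mul_left _
    have hcs' : Summable c' := ha.mul_left _
    have hes' : Summable e' := ha.mul_left _
    set τ₁ : ℕ → ℝ := fun n => c' n + c n + c' n * c n
    set e₁ : ℕ → ℝ := fun n => e n + c' n * e n + e' n
    have hτ₁0 : ∀ n, 0 ≤ τ₁ n := fun n =>
      add_nonneg (add_nonneg (hc0' n) (hc0 n)) (mul_nonneg (hc0' n) (hc0 n))
    have he₁0 : ∀ n, 0 ≤ e₁ n := fun n =>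
      add_nonneg (add_nonneg (he0 n) (mul_nonneg (hc0' n) (he0 n))) (he0' n)
    have hτ₁s : Summable τ₁ := (hcs'.add hcs).add (summable_mul_of_nonneg hc0' hc0 hcs' hcs)
    have he₁s : Summable e₁ := (hes.add (summable_mul_of_nonneg hc0' he0 hcs' hes)).add hes'
    refine exists_tendsto_and_summable_of_quasi_decreasing
      (τ := fun n => η n + τ₁ n + η n * τ₁ n) (e := fun n => e₁ n + η n * e₁ n)
      (fun n => (hW n).inner_nonneg hα _) (fun n => ?_)
      (fun n => add_nonneg (add_nonneg (hη0 n) (hτ₁0 n)) (mul_nonneg (hη0 n) (hτ₁0 n)))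
      (fun n => add_nonneg (he₁0 n) (mul_nonneg (hη0 n) (he₁0 n)))
      ((hηsum.add hτ₁s).add (summable_mul_of_nonneg hη0 hτ₁0 hηsum hτ₁s))
      (he₁s.add (summable_mul_of_nonneg hη0 he₁0 hηsum he₁s)) (fun n => ?_)
    · have := (hW n).inner_nonneg hα (x n - p n - gam n • U n (B (x n) - B z))
      positivity
    set R := ε ^ 2 * ‖B (x n) - B z‖ ^ 2 +
        ⟪W n (x n - p n - gam n • U n (B (x n) - B z)),
          x n - p n - gam n • U n (B (x n) - B z)⟫
    have hR : 0 ≤ R := by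
      have := (hW n).inner_nonneg hα (x n - p n - gam n • U n (B (x n) - B z))
      positivity
    have hγm : gam n * μ ≤ 2 * β - ε := by
      have := (hgam n).2
      rwa [hG, le_div_iff₀ hμ0] at this
    have h1 : ⟪W n (p n - z), p n - z⟫ + R ≤
        ⟪W n (x n - z), x n - z⟫ + 2 * (gam n * (‖b n‖ * ‖p n - z‖)) := by
      refine (hW n).forward_backward_descent hε0 (hgam n).1 hγm (u := u n) (c := B z) ?_ ?_
        (hB _ _)
      · have := hAmono _ _ _ _ (hu n) hz
        rwa [sub_neg_eq_add] at this
      · rw [hxp]; congr 3; abel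
    have h2 := (hW n).descent_absorb_error hα hμ0 (hγ0 n).le (hgam n).2 (hKb n) hR h1
    obtain ⟨hlε, hl1⟩ := hlam n
    have hl0 : 0 ≤ lam n := hε0.le.trans hlε
    have hxz : x (n + 1) - z = ((1 - lam n) • (x n - z) + lam n • (p n - z)) + lam n • a n := by
      rw [hx]; module
    have h3 := (hW n).inner_convex hα hl0 hl1 (x n - z) (p n - z)
    have h4 := (hW n).inner_add_smul_le hα hμ0 hl0 hl1
      ((1 - lam n) • (x n - z) + lam n • (p n - z)) (a n) (hKa n)
    rw [← hxz] at h4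
    have h5 := hWmono n (x (n + 1) - z)
    change ⟪W (n + 1) (x (n + 1) - z), x (n + 1) - z⟫ + ε * R ≤
      (1 + (η n + τ₁ n + η n * τ₁ n)) * ⟪W n (x n - z), x n - z⟫ + (e₁ n + η n * e₁ n)
    have hS0 := (hW n).inner_nonneg hα (x n - z)
    change _ ≤ (1 + c n) * _ + e n at h2
    change _ ≤ (1 + c' n) * _ + e' n at h4
    generalize ⟪W n ((1 - lam n) • (x n - z) + lam n • (p n - z)),
      (1 - lam n) • (x n - z) + lam n • (p n - z)⟫ = Q at h3 h4
    generalize ⟪W n (x n - z), x n - z⟫ = S at *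
    generalize ⟪W n (p n - z), p n - z⟫ = T at *
    generalize ⟪W n (x (n + 1) - z), x (n + 1) - z⟫ = S' at *
    have h6 : Q + ε * R ≤ (1 + c n) * S + e n := by
      have q1 := mul_le_mul_of_nonneg_left h2 hl0
      have q2 : 0 ≤ (1 - lam n) * (c n * S + e n) :=
        mul_nonneg (by linarith) (add_nonneg (mul_nonneg (hc0 n) hS0) (he0 n))
      have q3 := mul_le_mul_of_nonneg_right hlε hR
      nlinarith
    have hεR : 0 ≤ ε * R := mul_nonneg hε0.le hR
    have h7 : S' + ε * R ≤ (1 + τ₁ n) * S + e₁ n := by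
      have q1 := mul_le_mul_of_nonneg_left h6 (hc0' n)
      have q2 := mul_nonneg (hc0' n) hεR
      simp only [τ₁, e₁]
      nlinarith
    have q1 := mul_le_mul_of_nonneg_left h7 (hη0 n)
    have q2 := mul_nonneg (hη0 n) hεR
    nlinarith
  have hsumB : ∀ z, -B z ∈ A z → Summable fun n => ‖B (x n) - B z‖ ^ 2 := by
    intro z hz
    refine Summable.of_nonneg_of_le (fun n => sq_nonneg _) (fun n => ?_)
      ((key z hz).2.mul_left (ε ^ 3)⁻¹)
    have := (hW n).inner_nonneg hα (x n - p n - gam n • U n (B (x n) - B z))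
    rw [le_inv_mul_iff₀ (by positivity)]
    nlinarith
  obtain ⟨z₀, hz₀⟩ := hZ
  have hz₀ : -B z₀ ∈ A z₀ := hz₀
  -- Boundedness of the iterates
  obtain ⟨M, hM⟩ : ∃ M, ∀ n, ‖x n‖ ≤ M := by
    obtain ⟨l, hl⟩ := (key z₀ hz₀).1
    obtain ⟨C, hC⟩ := hl.bddAbove_range
    refine ⟨1 + μ * C + ‖z₀‖, fun n => ?_⟩
    have h1 := (hW n).sq_norm_le hα hμ0 (x n - z₀)
    have h2 := mul_le_mul_of_nonneg_left (hC ⟨n, rfl⟩) hμ0.le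
    simp only at h2
    have h3 := norm_le_norm_sub_add (x n) z₀
    nlinarith [sq_nonneg (‖x n - z₀‖ - 1)]
  have hBlim : Tendsto (fun n => B (x n)) atTop (𝓝 (B z₀)) := by
    rw [tendsto_iff_norm_sub_tendsto_zero]
    have := (hsumB z₀ hz₀).tendsto_atTop_zero.sqrt
    simpa [Real.sqrt_sq] using this
  have hxplim : Tendsto (fun n => x n - p n) atTop (𝓝 0) := by
    have h1 : Tendsto (fun n => x n - p n - gam n • U n (B (x n) - B z₀)) atTop (𝓝 0) := by
      have h2 := ((key z₀ hz₀).2.mul_left (μ * ε⁻¹)).tendsto_atTop_zero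
      have h3 : Tendsto (fun n => ‖x n - p n - gam n • U n (B (x n) - B z₀)‖ ^ 2) atTop (𝓝 0) := by
        refine squeeze_zero (fun n => sq_nonneg _) (fun n => ?_) h2
        refine ((hW n).sq_norm_le hα hμ0 _).trans ?_
        rw [mul_assoc, inv_mul_cancel_left₀ hε0.ne']
        refine mul_le_mul_of_nonneg_left ?_ hμ0.le
        exact le_add_of_nonneg_left (by positivity)
      rw [tendsto_zero_iff_norm_tendsto_zero]
      simpa [Real.sqrt_sq] using h3.sqrt
    have h2 : Tendsto (fun n => gam n • U n (B (x n) - B z₀)) atTop (𝓝 0) := by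
      have h3 := (tendsto_iff_norm_sub_tendsto_zero.1 hBlim).const_mul
        ((2 * β - ε) / μ * μ)
      rw [mul_zero] at h3
      refine squeeze_zero_norm (fun n => ?_) h3
      rw [norm_smul, Real.norm_of_nonneg (hγ0 n).le, mul_assoc]
      exact mul_le_mul (hgam n).2 ((U n).le_of_opNorm_le (hUm n) _) (norm_nonneg _)
        ((hγ0 n).le.trans (hgam n).2)
    simpa using h1.add h2
  have hulim : Tendsto u atTop (𝓝 (-B z₀)) := by
    have h1 : Tendsto (fun n => (gam n)⁻¹ • W n (x n - p n)) atTop (𝓝 0) := by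
      have h2 := (tendsto_zero_iff_norm_tendsto_zero.1 hxplim).const_mul (ε⁻¹ * α⁻¹)
      rw [mul_zero] at h2
      refine squeeze_zero_norm (fun n => ?_) h2
      rw [norm_smul, norm_inv, Real.norm_of_nonneg (hγ0 n).le, mul_assoc]
      refine mul_le_mul (inv_anti₀ hε0 (hgam n).1) ?_ (norm_nonneg _) (inv_pos.2 hε0).le
      rw [le_inv_mul_iff₀ hα]
      exact (hW n).norm_inv_le _
    have h3 := (h1.sub hBlim).sub (tendsto_zero_iff_norm_tendsto_zero.2 hb.tendsto_atTop_zero)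
    rw [zero_sub, sub_zero] at h3
    refine h3.congr fun n => ?_
    rw [hxp, map_smul, hW2, inv_smul_smul₀ (hγ0 n).ne']
    abel
  -- Weak cluster points are zeros
  have hcluster : ∀ F : Ultrafilter ℕ, (F : Filter ℕ) ≤ atTop → ∀ z,
      (∀ w, Tendsto (fun n => ⟪x n, w⟫) F (𝓝 ⟪z, w⟫)) → -B z ∈ A z := by
    intro F hF z hz
    have hBz : B z = B z₀ := by
      have h1 : Tendsto (fun n => B (x n) - B z) F (𝓝 (B z₀ - B z)) :=
        (hBlim.mono_left hF).sub_const _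
      have h2 : Tendsto (fun n => ⟪x n - z, B (x n) - B z⟫) F (𝓝 0) := by
        have h3 := (tendsto_inner_of_weak_of_strong hM hz h1).sub
          ((tendsto_const_nhds (x := z)).inner h1)
        simpa [← inner_sub_left] using h3
      have h3 := le_of_tendsto_of_tendsto ((h1.norm.pow 2).const_mul β) h2
        (Eventually.of_forall fun n => hB _ _)
      have h4 : ‖B z₀ - B z‖ ^ 2 ≤ 0 := by
        by_contra! h
        exact absurd h3 (not_le.2 (mul_pos hβ h))
      have h5 : ‖B z₀ - B z‖ = 0 := by
        simpa using le_antisymm h4 (sq_nonneg _)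
      exact (sub_eq_zero.1 (norm_eq_zero.1 h5)).symm
    refine hAmax z _ fun x' u' hu' => ?_
    rw [hBz]
    have h1 : Tendsto (fun n => u' - u n) F (𝓝 (u' - -B z₀)) :=
      (hulim.mono_left hF).const_sub _
    have h2 := ((tendsto_const_nhds (x := x')).inner h1).sub
      (tendsto_inner_of_weak_of_strong hM hz h1)
    have h3 := h2.add ((hxplim.mono_left hF).inner h1)
    rw [inner_zero_left, add_zero, ← inner_sub_left] at h3
    refine ge_of_tendsto h3 (Eventually.of_forall fun n => ?_)
    rw [← inner_sub_left, ← inner_add_left]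
    have := hAmono _ _ _ _ hu' (hu n)
    rwa [sub_add_sub_cancel]
  -- Weak cluster points are unique
  have hunique : ∀ F G : Ultrafilter ℕ, (F : Filter ℕ) ≤ atTop → (G : Filter ℕ) ≤ atTop → ∀ z z',
      (∀ w, Tendsto (fun n => ⟪x n, w⟫) F (𝓝 ⟪z, w⟫)) →
      (∀ w, Tendsto (fun n => ⟪x n, w⟫) G (𝓝 ⟪z', w⟫)) → z = z' := by
    intro F G hF hG z z' hz hz'
    have hWlim := exists_tendsto_of_quasi_antitone (k := α⁻¹) (inv_pos.2 hα) hη0 hηsum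
      (fun n => (hW n).inv_symm) (fun n => (hW n).inner_nonneg hα)
      (fun n x => by rw [le_inv_mul_iff₀ hα]; exact (hW n).inner_le hα x) hWmono
    obtain ⟨v, hv⟩ := hWlim (z - z')
    obtain ⟨l, hl⟩ := (key z (hcluster F hF z hz)).1
    obtain ⟨l', hl'⟩ := (key z' (hcluster G hG z' hz')).1
    have hlim : Tendsto (fun n => ⟪x n, W n (z - z')⟫) atTop
        (𝓝 ((l' - l + ⟪z + z', v⟫) / 2)) := by
      refine (((hl'.sub hl).add ((tendsto_const_nhds (x := z + z')).inner hv)).div_const 2).congr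
        fun n => ?_
      have e1 := (hW n).inv_symm (x n) z
      have e2 := (hW n).inv_symm (x n) z'
      have e3 := (hW n).inv_symm z z'
      have e4 := real_inner_comm (x n) (W n z)
      have e5 := real_inner_comm (x n) (W n z')
      have e6 := real_inner_comm z (W n z')
      have e7 := real_inner_comm z (W n z)
      have e8 := real_inner_comm z' (W n z')
      have e9 := real_inner_comm z' (W n z)
      simp only [map_sub, inner_sub_left, inner_sub_right, inner_add_left]
      linarith
    have h1 := tendsto_nhds_unique (hlim.mono_left hF)
      (tendsto_inner_of_weak_of_strong hM hz (hv.mono_left hF))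
    have h2 := tendsto_nhds_unique (hlim.mono_left hG)
      (tendsto_inner_of_weak_of_strong hM hz' (hv.mono_left hG))
    have h3 : ‖z - z'‖ ^ 2 ≤ μ * ⟪v, z - z'⟫ :=
      ge_of_tendsto ((hv.inner tendsto_const_nhds).const_mul μ)
        (Eventually.of_forall fun n => (hW n).sq_norm_le hα hμ0 _)
    rw [real_inner_comm, inner_sub_left, ← h1, ← h2, sub_self, mul_zero] at h3
    have h4 : ‖z - z'‖ = 0 := by
      simpa using le_antisymm h3 (sq_nonneg _)
    exact sub_eq_zero.1 (norm_eq_zero.1 h4)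
  obtain ⟨xb, hxb⟩ := exists_weak_limit_of_bounded hM (Ultrafilter.of atTop)
  have hof : ((Ultrafilter.of atTop : Ultrafilter ℕ) : Filter ℕ) ≤ atTop := Ultrafilter.of_le _
  have hxbZ := hcluster _ hof xb hxb
  refine ⟨xb, hxbZ, fun w => ?_, hsumB xb hxbZ⟩
  rw [tendsto_iff_ultrafilter]
  intro F hF
  obtain ⟨z, hz⟩ := exists_weak_limit_of_bounded hM F
  rw [hunique _ F hof hF xb z hxb hz]
  exact hz w
end

section
/- Under the variable metric forward–backward setup, if in addition at every point z ∈ Z either A is demiregular at z or B is demiregular at z (with B identified with the set-valued operator x ↦ {Bx}), then the sequence (x_n) converges strongly to some point x̄ ∈ Z. -/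
open RealInnerProductSpace Filter Topology

/-- An operator `M : H → Set H` is demiregular at `x` if `M x ≠ ∅` and for every
sequence `(xs n, us n)` in the graph of `M` and every `u ∈ M x`, weak convergence
`xs n ⇀ x` together with strong convergence `us n → u` imply `xs n → x` strongly. -/
def Demiregular {H : Type*} [NormedAddCommGroup H] [InnerProductSpace ℝ H]
    (M : H → Set H) (x : H) : Prop :=
  (M x).Nonempty ∧
    ∀ xs us : ℕ → H, (∀ n, us n ∈ M (xs n)) → ∀ u ∈ M x,
      (∀ w : H, Filter.Tendsto (fun n => ⟪xs n, w⟫) Filter.atTop (nhds ⟪x, w⟫)) →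
      Filter.Tendsto us Filter.atTop (nhds u) →
      Filter.Tendsto xs Filter.atTop (nhds x)

/-- Bounded sequences in a Hilbert space have weakly convergent subsequences. -/
theorem exists_subseq_tendsto_inner_of_norm_le {H : Type*} [NormedAddCommGroup H]
    [InnerProductSpace ℝ H] [CompleteSpace H] (x : ℕ → H) (R : ℝ) (hR : ∀ n, ‖x n‖ ≤ R) :
    ∃ (xb : H) (φ : ℕ → ℕ), StrictMono φ ∧
      ∀ w : H, Tendsto (fun n => ⟪x (φ n), w⟫) atTop (𝓝 ⟪xb, w⟫) := by
  set K : Submodule ℝ H := (Submodule.span ℝ (Set.range x)).topologicalClosure with hK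
  have hxK : ∀ n, x n ∈ K := fun n =>
    Submodule.le_topologicalClosure _ (Submodule.subset_span (Set.mem_range_self n))
  have hKc : IsClosed (K : Set H) := Submodule.isClosed_topologicalClosure _
  have : CompleteSpace K := hKc.completeSpace_coe
  have : TopologicalSpace.SeparableSpace K := by
    have h : TopologicalSpace.IsSeparable (K : Set H) :=
      ((Set.countable_range x).isSeparable.span (R := ℝ)).closure
    exact h.separableSpace
  let f : ℕ → WeakDual ℝ K := fun n =>
    StrongDual.toWeakDual (InnerProductSpace.toDual ℝ K ⟨x n, hxK n⟩)
  have hf : ∀ n, f n ∈ WeakDual.toStrongDual ⁻¹' Metric.closedBall (0 : StrongDual ℝ K) R := by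
    intro n
    have h : ‖InnerProductSpace.toDual ℝ K ⟨x n, hxK n⟩‖ ≤ R := by
      rw [LinearIsometryEquiv.norm_map]
      exact hR n
    exact mem_closedBall_zero_iff.2 h
  obtain ⟨g, -, φ, hφ, hlim⟩ := WeakDual.isSeqCompact_closedBall ℝ K 0 R hf
  refine ⟨((InnerProductSpace.toDual ℝ K).symm (WeakDual.toStrongDual g) : K), φ, hφ, fun w => ?_⟩
  have hw := ((WeakDual.eval_continuous (𝕜 := ℝ) (K.orthogonalProjectionOnto w)).tendsto g).comp hlim
  have hinner : ∀ k : K, ⟪k, K.orthogonalProjectionOnto w⟫ = ⟪(k : H), w⟫ := fun k => by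
    simp
  rw [← hinner, InnerProductSpace.toDual_symm_apply]
  refine hw.congr fun n => ?_
  exact hinner ⟨x (φ n), hxK (φ n)⟩

theorem Summable.mul_of_nonneg_pointwise {f g : ℕ → ℝ} (hf : Summable f) (hg : Summable g)
    (hf0 : ∀ n, 0 ≤ f n) (hg0 : ∀ n, 0 ≤ g n) : Summable fun n => f n * g n := by
  refine Summable.of_nonneg_of_le (fun n => mul_nonneg (hf0 n) (hg0 n)) (fun n => ?_)
    (hf.mul_right (∑' n, g n))
  exact mul_le_mul_of_nonneg_left (hg.le_tsum n fun m _ => hg0 m) (hf0 n)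

/-- A deterministic Robbins–Siegmund lemma. -/
theorem exists_tendsto_of_le_one_add_mul_add {S D δ κ : ℕ → ℝ} (hS : ∀ n, 0 ≤ S n)
    (hD : ∀ n, 0 ≤ D n) (hδ0 : ∀ n, 0 ≤ δ n) (hκ0 : ∀ n, 0 ≤ κ n) (hδ : Summable δ)
    (hκ : Summable κ) (h : ∀ n, S (n + 1) + D n ≤ (1 + δ n) * S n + κ n) :
    (∃ L, Tendsto S atTop (𝓝 L)) ∧ Tendsto D atTop (𝓝 0) := by
  have hexp : ∀ n, S n ≤ Real.exp (∑ i ∈ Finset.range n, δ i) *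
      (S 0 + ∑ i ∈ Finset.range n, κ i) := by
    intro n
    induction n with
    | zero => simp
    | succ n ih =>
      rw [Finset.sum_range_succ, Finset.sum_range_succ, Real.exp_add]
      have hE : 1 ≤ Real.exp (∑ i ∈ Finset.range n, δ i) :=
        Real.one_le_exp (Finset.sum_nonneg fun i _ => hδ0 i)
      have hE' : 1 + δ n ≤ Real.exp (δ n) := by linarith [Real.add_one_le_exp (δ n)]
      have hE1 : 1 ≤ Real.exp (δ n) := Real.one_le_exp (hδ0 n)
      have hκ1 : κ n ≤ Real.exp (∑ i ∈ Finset.range n, δ i) * Real.exp (δ n) * κ n :=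
        le_mul_of_one_le_left (hκ0 n) (one_le_mul_of_one_le_of_one_le hE hE1)
      have hmul : (1 + δ n) * S n ≤ Real.exp (δ n) * (Real.exp (∑ i ∈ Finset.range n, δ i) *
          (S 0 + ∑ i ∈ Finset.range n, κ i)) :=
        mul_le_mul hE' ih (hS n) (Real.exp_pos _).le
      linarith [h n, hD n]
  obtain ⟨M, hM⟩ : ∃ M, ∀ n, S n ≤ M := by
    refine ⟨Real.exp (∑' i, δ i) * (S 0 + ∑' i, κ i), fun n => (hexp n).trans ?_⟩
    have h1 : ∑ i ∈ Finset.range n, κ i ≤ ∑' i, κ i := hκ.sum_le_tsum _ fun i _ => hκ0 i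
    have h2 : ∑ i ∈ Finset.range n, δ i ≤ ∑' i, δ i := hδ.sum_le_tsum _ fun i _ => hδ0 i
    have h3 : 0 ≤ ∑ i ∈ Finset.range n, κ i := Finset.sum_nonneg fun i _ => hκ0 i
    have h4 := hS 0
    gcongr
  set e : ℕ → ℝ := fun n => M * δ n + κ n with he
  have hesum : Summable e := (hδ.mul_left M).add hκ
  have hstep : ∀ n, S (n + 1) + D n ≤ S n + e n := fun n => by
    have := mul_le_mul_of_nonneg_left (hM n) (hδ0 n)
    simp only [he]
    linarith [h n]
  have hM0 : 0 ≤ M := (hS 0).trans (hM 0)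
  have he0 : ∀ n, 0 ≤ e n := fun n => add_nonneg (mul_nonneg hM0 (hδ0 n)) (hκ0 n)
  have hanti : Antitone fun n => S n - ∑ i ∈ Finset.range n, e i := by
    refine antitone_nat_of_succ_le fun n => ?_
    rw [Finset.sum_range_succ]
    linarith [hstep n, hD n]
  have hbdd : BddBelow (Set.range fun n => S n - ∑ i ∈ Finset.range n, e i) := by
    refine ⟨-∑' i, e i, ?_⟩
    rintro _ ⟨n, rfl⟩
    have := hesum.sum_le_tsum (Finset.range n) fun i _ => he0 i
    dsimp only
    linarith [hS n]
  have hlim : Tendsto S atTop (𝓝 ((⨅ n, (S n - ∑ i ∈ Finset.range n, e i)) + ∑' i, e i)) := by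
    simpa using (tendsto_atTop_ciInf hanti hbdd).add hesum.hasSum.tendsto_sum_nat
  refine ⟨⟨_, hlim⟩, ?_⟩
  refine squeeze_zero hD (fun n => (by linarith [hstep n] : D n ≤ S n - S (n + 1) + e n)) ?_
  simpa using (hlim.sub (hlim.comp (tendsto_add_atTop_nat 1))).add hesum.tendsto_atTop_zero

/-- A bounded self-adjoint operator that is bounded below by `α` and has norm at most `μ` has a
symmetric inverse whose quadratic form lies between `α / μ ^ 2` and `α⁻¹`. -/
theorem exists_symmetric_inverse_of_coercive {H : Type*} [NormedAddCommGroup H]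
    [InnerProductSpace ℝ H] [CompleteSpace H] {U : H →L[ℝ] H} (hU : IsSelfAdjoint U)
    {α μ : ℝ} (hα : 0 < α) (hμ : 0 < μ) (hUα : ∀ x : H, ⟪U x, x⟫ ≥ α * ‖x‖ ^ 2)
    (hUμ : ‖U‖ ≤ μ) :
    ∃ V : H →L[ℝ] H, (∀ x, U (V x) = x) ∧ (∀ x, V (U x) = x) ∧
      (∀ x y, ⟪V x, y⟫ = ⟪V y, x⟫) ∧ (∀ x, ‖V x‖ ≤ α⁻¹ * ‖x‖) ∧
      (∀ x, ⟪V x, x⟫ ≤ α⁻¹ * ‖x‖ ^ 2) ∧ ∀ x, α / μ ^ 2 * ‖x‖ ^ 2 ≤ ⟪V x, x⟫ := by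
  have hsymm : ∀ x y, ⟪U x, y⟫ = ⟪x, U y⟫ := fun x y => hU.isSymmetric x y
  have hco : IsCoercive ((innerSL ℝ).comp U) := ⟨α, hα, fun x => by
    have := hUα x
    simp only [ContinuousLinearMap.comp_apply, innerSL_apply_apply]
    linarith⟩
  set E := hco.continuousLinearEquivOfBilin
  have hE : ∀ x, E x = U x := fun x =>
    (hco.unique_continuousLinearEquivOfBilin fun w => rfl).symm
  have hUV : ∀ x, U (E.symm x) = x := fun x => by rw [← hE, E.apply_symm_apply]
  have hVx : ∀ x, α * ‖E.symm x‖ ^ 2 ≤ ⟪E.symm x, x⟫ := fun x => by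
    have := hUα (E.symm x)
    rw [hUV, real_inner_comm] at this
    exact this
  have hVn : ∀ x, ‖E.symm x‖ ≤ α⁻¹ * ‖x‖ := fun x => by
    rw [inv_mul_eq_div, le_div_iff₀ hα]
    rcases (norm_nonneg (E.symm x)).eq_or_lt with h0 | h0
    · rw [← h0]
      simp
    · refine le_of_mul_le_mul_right ?_ h0
      nlinarith [hVx x, real_inner_le_norm (E.symm x) x]
  refine ⟨E.symm, hUV, fun x => ?_, fun x y => ?_, hVn, fun x => ?_, fun x => ?_⟩
  · have := E.symm_apply_apply x
    rwa [hE] at this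
  · calc ⟪E.symm x, y⟫ = ⟪E.symm x, U (E.symm y)⟫ := by rw [hUV]
      _ = ⟪E.symm y, x⟫ := by rw [← hsymm, hUV, real_inner_comm]
  · calc ⟪E.symm x, x⟫ ≤ ‖E.symm x‖ * ‖x‖ := real_inner_le_norm _ _
      _ ≤ α⁻¹ * ‖x‖ * ‖x‖ := mul_le_mul_of_nonneg_right (hVn x) (norm_nonneg x)
      _ = α⁻¹ * ‖x‖ ^ 2 := by ring
  · have h1 : ‖x‖ ≤ μ * ‖E.symm x‖ := by
      calc ‖x‖ = ‖U (E.symm x)‖ := by rw [hUV]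
        _ ≤ μ * ‖E.symm x‖ := U.le_of_opNorm_le hUμ _
    refine le_trans ?_ (hVx x)
    rw [div_mul_eq_mul_div, div_le_iff₀ (by positivity)]
    have h2 : ‖x‖ ^ 2 ≤ (μ * ‖E.symm x‖) ^ 2 := by gcongr
    nlinarith [mul_le_mul_of_nonneg_left h2 hα.le]

/-- Inversion reverses the Loewner order, up to a scalar factor. -/
theorem inner_inverse_le_of_inner_le {H : Type*} [NormedAddCommGroup H]
    [InnerProductSpace ℝ H] {U U' V V' : H →L[ℝ] H} {c : ℝ} (hc : 0 < c)
    (hUsymm : ∀ x y, ⟪U x, y⟫ = ⟪x, U y⟫) (hU0 : ∀ x, 0 ≤ ⟪U x, x⟫)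
    (hUV : ∀ x, U (V x) = x) (hUV' : ∀ x, U' (V' x) = x)
    (hle : ∀ x, c * ⟪U' x, x⟫ ≥ ⟪U x, x⟫) (x : H) :
    ⟪V' x, x⟫ ≤ c * ⟪V x, x⟫ := by
  have h1 := hU0 (c • V x - V' x)
  have h2 := hle (V' x)
  rw [hUV'] at h2
  have h3 : ⟪U (c • V x - V' x), c • V x - V' x⟫ =
      c ^ 2 * ⟪V x, x⟫ - 2 * c * ⟪V' x, x⟫ + ⟪U (V' x), V' x⟫ := by
    have h4 : ⟪U (V' x), V x⟫ = ⟪V' x, x⟫ := by rw [hUsymm, hUV]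
    simp only [map_sub, map_smul, hUV, inner_sub_left, inner_sub_right, inner_smul_left,
      inner_smul_right, h4, RCLike.conj_to_real]
    rw [real_inner_comm (V x) x, real_inner_comm (V' x) x]
    ring
  rw [h3] at h1
  rw [real_inner_comm] at h2
  refine le_of_mul_le_mul_left ?_ hc
  nlinarith

theorem Summable.one_add_mul {f g : ℕ → ℝ} (hf : Summable f) (hg : Summable g)
    (hf0 : ∀ n, 0 ≤ f n) (hg0 : ∀ n, 0 ≤ g n) : Summable fun n => (1 + f n) * g n :=
  (hg.add (hf.mul_of_nonneg_pointwise hg hf0 hg0)).congr fun n => by ring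

theorem Summable.one_add_mul_one_add_sub_one {f g : ℕ → ℝ} (hf : Summable f) (hg : Summable g)
    (hf0 : ∀ n, 0 ≤ f n) (hg0 : ∀ n, 0 ≤ g n) :
    Summable fun n => (1 + f n) * (1 + g n) - 1 :=
  (hf.add (hf.one_add_mul hg hf0 hg0)).congr fun n => by ring

section ForwardBackward

variable {H : Type*} [NormedAddCommGroup H] [InnerProductSpace ℝ H]

theorem inner_symm_add_self {V : H →L[ℝ] H} (hV : ∀ x y, ⟪V x, y⟫ = ⟪V y, x⟫) (u v : H) :
    ⟪V (u + v), u + v⟫ = ⟪V u, u⟫ + 2 * ⟪V u, v⟫ + ⟪V v, v⟫ := by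
  rw [map_add, inner_add_left, inner_add_right, inner_add_right, hV v u]
  ring

theorem inner_symm_sub_self {V : H →L[ℝ] H} (hV : ∀ x y, ⟪V x, y⟫ = ⟪V y, x⟫) (u v : H) :
    ⟪V (u - v), u - v⟫ = ⟪V u, u⟫ - 2 * ⟪V u, v⟫ + ⟪V v, v⟫ := by
  rw [map_sub, inner_sub_left, inner_sub_right, inner_sub_right, hV v u]
  ring

/-- The basic energy estimate of a forward–backward step in the metric of `V = U⁻¹`; here `u` is
the element of `A p` selected by the backward step and `-bz ∈ A z`. -/
theorem forward_backward_energy_le {U V : H →L[ℝ] H} (hV : ∀ x y, ⟪V x, y⟫ = ⟪V y, x⟫)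
    (hVU : ∀ x, V (U x) = x) {β γ μ : ℝ} (hγ : 0 ≤ γ) (hUμ : ‖U‖ ≤ μ)
    {x p z u bx bz b : H} (hstep : x - γ • U (bx + b) - p = γ • U u)
    (hmono : 0 ≤ ⟪p - z, u - -bz⟫) (hcoco : β * ‖bx - bz‖ ^ 2 ≤ ⟪x - z, bx - bz⟫) :
    ⟪V (p - z), p - z⟫ + ⟪V (x - p - γ • U (bx - bz)), x - p - γ • U (bx - bz)⟫ ≤
      ⟪V (x - z), x - z⟫ - γ * (2 * β - γ * μ) * ‖bx - bz‖ ^ 2 - 2 * γ * ⟪b, p - z⟫ := by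
  set d := bx - bz with hd
  set w := x - p with hw
  have hVw : V w = γ • ((u - -bz) + d + b) := by
    have h1 : w = γ • U ((u - -bz) + d + b) := by
      have h2 : w = γ • U u + γ • U (bx + b) := by rw [← hstep, hw]; abel
      rw [h2, ← smul_add, ← map_add, hd]
      congr 2
      abel
    rw [h1, map_smul, hVU]
  have hP : ⟪V (p - z), p - z⟫ = ⟪V (x - z), x - z⟫ - 2 * ⟪V w, p - z⟫ - ⟪V w, w⟫ := by
    have h1 : p - z = (x - z) - w := by rw [hw]; abel
    rw [h1, inner_symm_sub_self hV, hV (x - z) w, inner_sub_right (V w) (x - z) w]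
    ring
  have hR : ⟪V (w - γ • U d), w - γ • U d⟫ =
      ⟪V w, w⟫ - 2 * γ * ⟪d, w⟫ + γ ^ 2 * ⟪d, U d⟫ := by
    rw [inner_symm_sub_self hV, hV w (γ • U d), map_smul, hVU]
    simp only [inner_smul_left, inner_smul_right, RCLike.conj_to_real]
    ring
  have hcross : ⟪V w, p - z⟫ =
      γ * (⟪p - z, u - -bz⟫ + (⟪x - z, d⟫ - ⟪d, w⟫) + ⟪b, p - z⟫) := by
    have h1 : ⟪d, p - z⟫ = ⟪x - z, d⟫ - ⟪d, w⟫ := by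
      rw [real_inner_comm (x - z) d |>.symm, ← inner_sub_right, hw]
      congr 1
      abel
    rw [hVw, inner_smul_left, inner_add_left, inner_add_left, h1,
      real_inner_comm (u - -bz) (p - z)]
    simp
  have hUd : ⟪d, U d⟫ ≤ μ * ‖d‖ ^ 2 := by
    calc ⟪d, U d⟫ ≤ ‖d‖ * ‖U d‖ := real_inner_le_norm _ _
      _ ≤ ‖d‖ * (μ * ‖d‖) := by gcongr; exact U.le_of_opNorm_le hUμ d
      _ = μ * ‖d‖ ^ 2 := by ring
  rw [hP, hR, hcross]
  nlinarith [mul_nonneg hγ hmono, mul_le_mul_of_nonneg_left hcoco hγ,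
    mul_le_mul_of_nonneg_left hUd (sq_nonneg γ)]

/-- The energy estimate with the error term absorbed into the descent terms. -/
theorem forward_backward_energy_le_of_bounds {U V : H →L[ℝ] H}
    (hV : ∀ x y, ⟪V x, y⟫ = ⟪V y, x⟫) (hVU : ∀ x, V (U x) = x) {β γ μ m ε G : ℝ} (hε : 0 < ε)
    (hεγ : ε ≤ γ) (hγG : γ ≤ G) (hm : 0 < m) (hVm : ∀ x, m * ‖x‖ ^ 2 ≤ ⟪V x, x⟫)
    (hUμ : ‖U‖ ≤ μ) (hγμ : ε ≤ 2 * β - γ * μ)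
    {x p z u bx bz b : H} (hstep : x - γ • U (bx + b) - p = γ • U u)
    (hmono : 0 ≤ ⟪p - z, u - -bz⟫) (hcoco : β * ‖bx - bz‖ ^ 2 ≤ ⟪x - z, bx - bz⟫) :
    ⟪V (p - z), p - z⟫ ≤ (1 + G / m * ‖b‖) * ⟪V (x - z), x - z⟫
      - (m / 2 * ‖x - p - γ • U (bx - bz)‖ ^ 2 + ε ^ 2 / 2 * ‖bx - bz‖ ^ 2)
      + (G * ‖b‖ + (2 * G ^ 2 / m + 2 * G ^ 4 * μ ^ 2 / ε ^ 2) * (‖b‖ * ‖b‖)) := by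
  have hγ : 0 < γ := hε.trans_le hεγ
  have hG : 0 < G := hγ.trans_le hγG
  have hμ : 0 ≤ μ := (norm_nonneg U).trans hUμ
  have henergy := forward_backward_energy_le hV hVU hγ.le hUμ hstep hmono hcoco
  set d := bx - bz
  set r := x - p - γ • U d with hr
  have hpz : ‖p - z‖ ≤ ‖x - z‖ + ‖r‖ + G * (μ * ‖d‖) := by
    have h1 : p - z = (x - z) - r - γ • U d := by rw [hr]; abel
    have h2 : ‖γ • U d‖ ≤ G * (μ * ‖d‖) := by
      rw [norm_smul, Real.norm_of_nonneg hγ.le]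
      exact mul_le_mul hγG (U.le_of_opNorm_le hUμ d) (norm_nonneg _) hG.le
    rw [h1]
    linarith [norm_sub_le (x - z - r) (γ • U d), norm_sub_le (x - z) r]
  have herr : -(2 * γ * ⟪b, p - z⟫) ≤
      2 * G * (‖b‖ * (‖x - z‖ + ‖r‖ + G * (μ * ‖d‖))) := by
    have h1 : -⟪b, p - z⟫ ≤ ‖b‖ * ‖p - z‖ :=
      (neg_le_abs _).trans (abs_real_inner_le_norm _ _)
    have h2 : γ * -⟪b, p - z⟫ ≤ G * (‖b‖ * (‖x - z‖ + ‖r‖ + G * (μ * ‖d‖))) :=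
      calc γ * -⟪b, p - z⟫ ≤ γ * (‖b‖ * ‖p - z‖) := by gcongr
        _ ≤ _ := by gcongr
    linarith
  have hx : 2 * G * (‖b‖ * ‖x - z‖) ≤ G * ‖b‖ + G / m * ‖b‖ * ⟪V (x - z), x - z⟫ := by
    have h1 : G / m * ‖b‖ * (m * ‖x - z‖ ^ 2) ≤ G / m * ‖b‖ * ⟪V (x - z), x - z⟫ := by
      gcongr
      exact hVm _
    have h2 : G / m * ‖b‖ * (m * ‖x - z‖ ^ 2) = G * ‖b‖ * ‖x - z‖ ^ 2 := by field_simp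
    have h3 : 0 ≤ G * ‖b‖ * (‖x - z‖ - 1) ^ 2 := by positivity
    linarith
  have hrb : 2 * G * (‖b‖ * ‖r‖) ≤ m / 2 * ‖r‖ ^ 2 + 2 * G ^ 2 / m * (‖b‖ * ‖b‖) := by
    have h1 : 0 ≤ m / 2 * (‖r‖ - 2 * G / m * ‖b‖) ^ 2 := by positivity
    have h2 : m / 2 * (‖r‖ - 2 * G / m * ‖b‖) ^ 2 =
        m / 2 * ‖r‖ ^ 2 + 2 * G ^ 2 / m * (‖b‖ * ‖b‖) - 2 * G * (‖b‖ * ‖r‖) := by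
      field_simp
      ring
    linarith
  have hdb : 2 * G * (‖b‖ * (G * (μ * ‖d‖))) ≤
      ε ^ 2 / 2 * ‖d‖ ^ 2 + 2 * G ^ 4 * μ ^ 2 / ε ^ 2 * (‖b‖ * ‖b‖) := by
    have h1 : 0 ≤ 1 / 2 * (ε * ‖d‖ - 2 * G ^ 2 * μ / ε * ‖b‖) ^ 2 := by positivity
    have h2 : 1 / 2 * (ε * ‖d‖ - 2 * G ^ 2 * μ / ε * ‖b‖) ^ 2 = ε ^ 2 / 2 * ‖d‖ ^ 2
        + 2 * G ^ 4 * μ ^ 2 / ε ^ 2 * (‖b‖ * ‖b‖) - 2 * G * (‖b‖ * (G * (μ * ‖d‖))) := by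
      field_simp
      ring
    linarith
  have hd : ε ^ 2 * ‖d‖ ^ 2 ≤ γ * (2 * β - γ * μ) * ‖d‖ ^ 2 := by
    gcongr
    nlinarith
  linarith [hVm r]

/-- Relaxation with an additive perturbation, measured in the metric of `V`. -/
theorem inner_relaxation_le {V : H →L[ℝ] H} (hV : ∀ x y, ⟪V x, y⟫ = ⟪V y, x⟫)
    {C m ε l : ℝ} (hC : 0 ≤ C) (hm : 0 < m) (hVm : ∀ x, m * ‖x‖ ^ 2 ≤ ⟪V x, x⟫)
    (hVC : ∀ x, ‖V x‖ ≤ C * ‖x‖) (hε : 0 ≤ ε) (hεl : ε ≤ l) (hl1 : l ≤ 1)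
    {x p z a : H} {δ D κ : ℝ} (hδ : 0 ≤ δ) (hκ : 0 ≤ κ) (hD : 0 ≤ D)
    (hp : ⟪V (p - z), p - z⟫ ≤ (1 + δ) * ⟪V (x - z), x - z⟫ - D + κ) :
    ⟪V (x + l • (p + a - x) - z), x + l • (p + a - x) - z⟫ + ε * D ≤
      (1 + C / m * ‖a‖) * (1 + δ) * ⟪V (x - z), x - z⟫
        + ((1 + C / m * ‖a‖) * κ + C * (‖a‖ + ‖a‖ * ‖a‖)) := by
  have hV0 : ∀ x, 0 ≤ ⟪V x, x⟫ := fun x => le_trans (by positivity) (hVm x)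
  have hl0 : 0 ≤ l := hε.trans hεl
  set S := ⟪V (x - z), x - z⟫ with hS
  set q := (x - z) + l • (p - x) with hq
  have hqT : ⟪V q, q⟫ ≤ (1 + δ) * S - ε * D + κ := by
    have h1 : ⟪V (p - z), p - z⟫ = S + 2 * ⟪V (x - z), p - x⟫ + ⟪V (p - x), p - x⟫ := by
      rw [← inner_symm_add_self hV]
      congr 2 <;> [congr 1; skip] <;> abel
    have h2 : ⟪V q, q⟫ = S + 2 * (l * ⟪V (x - z), p - x⟫) + l ^ 2 * ⟪V (p - x), p - x⟫ := by
      rw [hq, inner_symm_add_self hV, map_smul]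
      simp only [inner_smul_left, inner_smul_right, RCLike.conj_to_real]
      ring
    have h3 : 0 ≤ l * (1 - l) * ⟪V (p - x), p - x⟫ :=
      mul_nonneg (mul_nonneg hl0 (by linarith)) (hV0 _)
    have h4 : ⟪V q, q⟫ ≤ S + l * (⟪V (p - z), p - z⟫ - S) := by
      rw [h1, h2]
      linarith
    have h5 : l * (⟪V (p - z), p - z⟫ - S) ≤ l * (δ * S - D + κ) := by
      gcongr
      linarith
    have h6 : l * (δ * S) ≤ δ * S := mul_le_of_le_one_left (mul_nonneg hδ (hV0 _)) hl1
    have h7 : l * κ ≤ κ := mul_le_of_le_one_left hκ hl1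
    have h8 : ε * D ≤ l * D := by gcongr
    linarith
  have hx' : x + l • (p + a - x) - z = q + l • a := by
    rw [hq, show p + a - x = (p - x) + a by abel, smul_add]
    abel
  have hla : ‖l • a‖ ≤ ‖a‖ := by
    rw [norm_smul, Real.norm_of_nonneg hl0]
    exact mul_le_of_le_one_left (norm_nonneg a) hl1
  have hcross : 2 * ⟪V q, l • a⟫ ≤ C * ‖a‖ + C / m * ‖a‖ * ⟪V q, q⟫ := by
    have h1 : ⟪V q, l • a⟫ ≤ C * ‖q‖ * ‖a‖ :=
      (real_inner_le_norm _ _).trans (by gcongr; exact hVC q)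
    have h2 : C / m * ‖a‖ * (m * ‖q‖ ^ 2) ≤ C / m * ‖a‖ * ⟪V q, q⟫ := by
      gcongr
      exact hVm q
    have h3 : C / m * ‖a‖ * (m * ‖q‖ ^ 2) = C * ‖a‖ * ‖q‖ ^ 2 := by field_simp
    have h4 : 0 ≤ C * ‖a‖ * (‖q‖ - 1) ^ 2 := by positivity
    linarith
  have hsq : ⟪V (l • a), l • a⟫ ≤ C * (‖a‖ * ‖a‖) := by
    calc ⟪V (l • a), l • a⟫ ≤ ‖V (l • a)‖ * ‖l • a‖ := real_inner_le_norm _ _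
      _ ≤ C * ‖l • a‖ * ‖l • a‖ := by gcongr; exact hVC _
      _ ≤ C * ‖a‖ * ‖a‖ := by gcongr
      _ = C * (‖a‖ * ‖a‖) := by ring
  rw [hx', inner_symm_add_self hV]
  have hκ' : 0 ≤ C / m * ‖a‖ := by positivity
  have hmain := mul_le_mul_of_nonneg_left hqT (by linarith : 0 ≤ 1 + C / m * ‖a‖)
  have hεD : 0 ≤ C / m * ‖a‖ * (ε * D) := by positivity
  linarith

end ForwardBackward

/-- **Variable metric forward–backward splitting: strong convergence under
demiregularity.** Under the variable metric forward–backward setup, if at every point of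
`Z` either `A` or `B` is demiregular, then `x n` converges strongly to some point of `Z`. -/
theorem variable_metric_forward_backward_strong_demiregular
    {H : Type*} [NormedAddCommGroup H] [InnerProductSpace ℝ H] [CompleteSpace H]
    (A : H → Set H)
    (hAmono : ∀ x y u v : H, u ∈ A x → v ∈ A y → ⟪x - y, u - v⟫ ≥ 0)
    (hAmax : ∀ y v : H, (∀ x u : H, u ∈ A x → ⟪x - y, u - v⟫ ≥ 0) → v ∈ A y)
    (β : ℝ) (hβ : 0 < β) (B : H → H)
    (hB : ∀ x y : H, ⟪x - y, B x - B y⟫ ≥ β * ‖B x - B y‖ ^ 2)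
    (η : ℕ → ℝ) (hη0 : ∀ n, 0 ≤ η n) (hηsum : Summable η)
    (α : ℝ) (hα : 0 < α)
    (U : ℕ → H →L[ℝ] H) (hUsa : ∀ n, IsSelfAdjoint (U n))
    (hUα : ∀ n (x : H), ⟪U n x, x⟫ ≥ α * ‖x‖ ^ 2)
    (μ : ℝ) (hμ : IsLUB (Set.range fun n => ‖U n‖) μ)
    (hUmono : ∀ n (x : H), (1 + η n) * ⟪U (n + 1) x, x⟫ ≥ ⟪U n x, x⟫)
    (ε : ℝ) (hε : ε ∈ Set.Ioc 0 (min 1 (2 * β / (μ + 1))))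
    (lam : ℕ → ℝ) (hlam : ∀ n, lam n ∈ Set.Icc ε 1)
    (gam : ℕ → ℝ) (hgam : ∀ n, gam n ∈ Set.Icc ε ((2 * β - ε) / μ))
    (a b : ℕ → H) (ha : Summable fun n => ‖a n‖) (hb : Summable fun n => ‖b n‖)
    (Z : Set H) (hZdef : Z = {x : H | -B x ∈ A x}) (hZ : Z.Nonempty)
    (x y p : ℕ → H)
    (hy : ∀ n, y n = x n - gam n • U n (B (x n) + b n))
    (hp : ∀ n, y n - p n ∈ (fun u => gam n • U n u) '' A (p n))
    (hx : ∀ n, x (n + 1) = x n + lam n • (p n + a n - x n))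
    (hdemi : ∀ z ∈ Z, Demiregular A z ∨ Demiregular (fun w => {B w}) z) :
    ∃ xb ∈ Z, Tendsto x atTop (𝓝 xb) := by
  have hε0 : 0 < ε := hε.1
  have hUμ : ∀ n, ‖U n‖ ≤ μ := fun n => hμ.1 (Set.mem_range_self n)
  have hμ0 : 0 < μ := by
    refine ((norm_nonneg _).trans (hUμ 0)).lt_of_ne fun h => ?_
    have h1 := (hgam 0).1.trans (hgam 0).2
    rw [← h, div_zero] at h1
    linarith
  set G := (2 * β - ε) / μ with hGdef
  have hgam0 : ∀ n, 0 < gam n := fun n => hε0.trans_le (hgam n).1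
  have hG0 : 0 < G := (hgam0 0).trans_le (hgam 0).2
  have hgamμ : ∀ n, ε ≤ 2 * β - gam n * μ := fun n => by
    have h := (hgam n).2
    rw [hGdef, le_div_iff₀ hμ0] at h
    linarith
  choose V hUV hVU hVsymm hVnorm hVup hVlow using fun n =>
    exists_symmetric_inverse_of_coercive (hUsa n) hα hμ0 (hUα n) (hUμ n)
  set m := α / μ ^ 2 with hmdef
  have hm : 0 < m := by positivity
  have hα' : 0 < α⁻¹ := inv_pos.2 hα
  choose u huA hu using hp
  dsimp only at hu
  have hstep : ∀ n, x n - gam n • U n (B (x n) + b n) - p n = gam n • U n (u n) := fun n => by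
    rw [hu, hy]
  have hVnext : ∀ n w, ⟪V (n + 1) w, w⟫ ≤ (1 + η n) * ⟪V n w, w⟫ := fun n =>
    inner_inverse_le_of_inner_le (by linarith [hη0 n]) (fun x y => (hUsa n).isSymmetric x y)
      (fun w => le_trans (by positivity) (hUα n w)) (hUV n) (hUV (n + 1)) (hUmono n)
  have hfejer : ∀ z ∈ Z, (∃ L, Tendsto (fun n => ⟪V n (x n - z), x n - z⟫) atTop (𝓝 L)) ∧
      Tendsto (fun n => ε * (m / 2 * ‖x n - p n - gam n • U n (B (x n) - B z)‖ ^ 2 +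
        ε ^ 2 / 2 * ‖B (x n) - B z‖ ^ 2)) atTop (𝓝 0) := by
    intro z hz
    rw [hZdef] at hz
    have hδ : Summable fun n => G / m * ‖b n‖ := hb.mul_left _
    have hδ0 : ∀ n, 0 ≤ G / m * ‖b n‖ := fun n => by positivity
    have hρ : Summable fun n => α⁻¹ / m * ‖a n‖ := ha.mul_left _
    have hρ0 : ∀ n, 0 ≤ α⁻¹ / m * ‖a n‖ := fun n => by positivity
    have hκ : Summable fun n =>
        G * ‖b n‖ + (2 * G ^ 2 / m + 2 * G ^ 4 * μ ^ 2 / ε ^ 2) * (‖b n‖ * ‖b n‖) :=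
      (hb.mul_left G).add ((hb.mul_of_nonneg_pointwise hb (fun n => norm_nonneg _)
        fun n => norm_nonneg _).mul_left _)
    have hκ0 : ∀ n, 0 ≤
        G * ‖b n‖ + (2 * G ^ 2 / m + 2 * G ^ 4 * μ ^ 2 / ε ^ 2) * (‖b n‖ * ‖b n‖) :=
      fun n => by positivity
    have hτ : Summable fun n => α⁻¹ * (‖a n‖ + ‖a n‖ * ‖a n‖) :=
      (ha.add (ha.mul_of_nonneg_pointwise ha (fun n => norm_nonneg _)
        fun n => norm_nonneg _)).mul_left _
    have hρδ0 : ∀ n, 0 ≤ (1 + α⁻¹ / m * ‖a n‖) * (1 + G / m * ‖b n‖) - 1 := fun n => by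
      nlinarith [hρ0 n, hδ0 n, mul_nonneg (hρ0 n) (hδ0 n)]
    have hρδ := hρ.one_add_mul_one_add_sub_one hδ hρ0 hδ0
    have hV0 : ∀ n w, 0 ≤ ⟪V n w, w⟫ := fun n w => le_trans (by positivity) (hVlow n w)
    refine exists_tendsto_of_le_one_add_mul_add (fun n => hV0 n _) (fun n => by positivity)
      (fun n => ?_) (fun n => ?_) (hηsum.one_add_mul_one_add_sub_one hρδ hη0 hρδ0)
      (hηsum.one_add_mul ((hρ.one_add_mul hκ hρ0 hκ0).add hτ) hη0 fun n => ?_) fun n => ?_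
    · nlinarith [hη0 n, hρδ0 n, mul_nonneg (hη0 n) (hρδ0 n)]
    · have := hη0 n
      positivity
    · positivity
    · have hmono : 0 ≤ ⟪p n - z, u n - -B z⟫ := hAmono _ _ _ _ (huA n) hz
      have hdesc := forward_backward_energy_le_of_bounds (hVsymm n) (hVU n) hε0 (hgam n).1
        (hgam n).2 hm (hVlow n) (hUμ n) (hgamμ n) (hstep n) hmono (hB (x n) z)
      have hrelax := inner_relaxation_le (hVsymm n) hα'.le hm (hVlow n) (hVnorm n) hε0.le
        (hlam n).1 (hlam n).2 (a := a n) (hδ0 n) (hκ0 n) (by positivity) hdesc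
      rw [← hx n] at hrelax
      have hnext := hVnext n (x (n + 1) - z)
      have hmul := mul_le_mul_of_nonneg_left hrelax (by linarith [hη0 n] : 0 ≤ 1 + η n)
      have hηD : 0 ≤ η n * (ε * (m / 2 * ‖x n - p n - gam n • U n (B (x n) - B z)‖ ^ 2 +
          ε ^ 2 / 2 * ‖B (x n) - B z‖ ^ 2)) := mul_nonneg (hη0 n) (by positivity)
      linarith
  obtain ⟨z, hz⟩ := hZ
  obtain ⟨⟨L, hL⟩, hD⟩ := hfejer z hz
  have hd : Tendsto (fun n => ‖B (x n) - B z‖) atTop (𝓝 0) := by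
    have h : Tendsto (fun n => ‖B (x n) - B z‖ ^ 2) atTop (𝓝 0) := by
      refine squeeze_zero (fun n => by positivity) (fun n => ?_)
        (by simpa only [mul_zero] using hD.const_mul (2 / ε ^ 3))
      have h1 : 2 / ε ^ 3 * (ε * (ε ^ 2 / 2 * ‖B (x n) - B z‖ ^ 2)) = ‖B (x n) - B z‖ ^ 2 := by
        field_simp
      refine h1.symm.le.trans ?_
      gcongr
      exact le_add_of_nonneg_left (by positivity)
    simpa using h.sqrt
  have hr : Tendsto (fun n => ‖x n - p n - gam n • U n (B (x n) - B z)‖) atTop (𝓝 0) := by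
    have h : Tendsto (fun n => ‖x n - p n - gam n • U n (B (x n) - B z)‖ ^ 2) atTop (𝓝 0) := by
      refine squeeze_zero (fun n => by positivity) (fun n => ?_)
        (by simpa only [mul_zero] using hD.const_mul (2 / (ε * m)))
      have h1 : 2 / (ε * m) *
          (ε * (m / 2 * ‖x n - p n - gam n • U n (B (x n) - B z)‖ ^ 2)) =
          ‖x n - p n - gam n • U n (B (x n) - B z)‖ ^ 2 := by
        field_simp
      refine h1.symm.le.trans ?_
      gcongr
      exact le_add_of_nonneg_right (by positivity)
    simpa using h.sqrt
  have hBlim : Tendsto (fun n => B (x n)) atTop (𝓝 (B z)) := tendsto_iff_norm_sub_tendsto_zero.2 hd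
  have hxp : Tendsto (fun n => x n - p n) atTop (𝓝 0) := by
    refine squeeze_zero_norm (a := fun n => ‖x n - p n - gam n • U n (B (x n) - B z)‖ +
      G * (μ * ‖B (x n) - B z‖)) (fun n => ?_) (by simpa using hr.add ((hd.const_mul μ).const_mul G))
    have h1 : ‖gam n • U n (B (x n) - B z)‖ ≤ G * (μ * ‖B (x n) - B z‖) := by
      rw [norm_smul, Real.norm_of_nonneg (hgam0 n).le]
      exact mul_le_mul (hgam n).2 ((U n).le_of_opNorm_le (hUμ n) _) (norm_nonneg _) hG0.le
    linarith [norm_le_norm_sub_add (x n - p n) (gam n • U n (B (x n) - B z))]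
  have hulim : Tendsto u atTop (𝓝 (-B z)) := by
    rw [tendsto_iff_norm_sub_tendsto_zero]
    refine squeeze_zero (fun n => norm_nonneg _) (fun n => ?_)
      (by simpa only [mul_zero, add_zero] using (hr.const_mul (ε⁻¹ * α⁻¹)).add hb.tendsto_atTop_zero)
    set r := x n - p n - gam n • U n (B (x n) - B z) with hrdef
    have h1 : r = gam n • U n (u n + B z + b n) := by
      have h2 : x n - p n = gam n • U n (u n) + gam n • U n (B (x n) + b n) := by
        rw [← hstep n]
        abel
      rw [hrdef, h2, ← smul_add, ← smul_sub, ← map_add, ← map_sub]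
      congr 2
      abel
    have h2 : u n - -B z = (gam n)⁻¹ • V n r - b n := by
      rw [h1, map_smul, hVU, inv_smul_smul₀ (hgam0 n).ne']
      abel
    have h3 : ‖(gam n)⁻¹ • V n r‖ ≤ ε⁻¹ * α⁻¹ * ‖r‖ := by
      rw [norm_smul, Real.norm_of_nonneg (inv_nonneg.2 (hgam0 n).le), mul_assoc]
      exact mul_le_mul (inv_anti₀ hε0 (hgam n).1) (hVnorm n r) (norm_nonneg _)
        (inv_nonneg.2 hε0.le)
    rw [h2]
    linarith [norm_sub_le ((gam n)⁻¹ • V n r) (b n)]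
  obtain ⟨R, hR⟩ : ∃ R, ∀ n, ‖x n‖ ≤ R := by
    obtain ⟨M, hM⟩ := hL.bddAbove_range
    refine ⟨(M / m + 1) + ‖z‖, fun n => ?_⟩
    have h1 : ‖x n - z‖ ^ 2 ≤ M / m := by
      rw [le_div_iff₀ hm, mul_comm]
      exact (hVlow n _).trans (hM (Set.mem_range_self n))
    nlinarith [norm_le_norm_sub_add (x n) z, sq_nonneg (‖x n - z‖ - 1), norm_nonneg (x n - z)]
  obtain ⟨xb, φ, hφ, hweak⟩ := exists_subseq_tendsto_inner_of_norm_le x R hR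
  have hφt := hφ.tendsto_atTop
  have hweak_p : ∀ w : H, Tendsto (fun n => ⟪p (φ n), w⟫) atTop (𝓝 ⟪xb, w⟫) := fun w => by
    have h1 : Tendsto (fun n => ⟪x (φ n) - p (φ n), w⟫) atTop (𝓝 ⟪(0 : H), w⟫) :=
      (hxp.comp hφt).inner tendsto_const_nhds
    have h2 := (hweak w).sub h1
    simpa [inner_sub_left] using h2
  have hBxb : B xb = B z := by
    refine tendsto_nhds_unique ?_ (hBlim.comp hφt)
    rw [tendsto_iff_norm_sub_tendsto_zero]
    have h1 : Tendsto (fun n => ⟪x (φ n) - xb, B z - B xb⟫) atTop (𝓝 0) := by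
      have := (hweak (B z - B xb)).sub_const ⟪xb, B z - B xb⟫
      simpa only [← inner_sub_left, sub_self, inner_zero_left] using this
    have h2 : Tendsto (fun n => (R + ‖xb‖) * ‖B (x (φ n)) - B z‖) atTop (𝓝 0) := by
      simpa using (hd.comp hφt).const_mul (R + ‖xb‖)
    have h3 : Tendsto (fun n => ‖B (x (φ n)) - B xb‖ ^ 2) atTop (𝓝 0) := by
      refine squeeze_zero (fun n => by positivity) (fun n => ?_)
        (by simpa using (h1.add h2).const_mul β⁻¹)
      rw [inv_mul_eq_div, le_div_iff₀ hβ, mul_comm]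
      refine (hB (x (φ n)) xb).le.trans ?_
      have h4 : B (x (φ n)) - B xb = (B z - B xb) + (B (x (φ n)) - B z) := by abel
      rw [h4, inner_add_right]
      gcongr
      refine (real_inner_le_norm _ _).trans ?_
      gcongr
      exact (norm_sub_le _ _).trans (by gcongr; exact hR _)
    simpa using h3.sqrt
  have hxbA : -B xb ∈ A xb := by
    refine hAmax _ _ fun w v hv => ?_
    rw [hBxb]
    have h1 : Tendsto (fun n => ⟪w - p (φ n), v - -B z⟫) atTop (𝓝 ⟪w - xb, v - -B z⟫) := by
      simp only [inner_sub_left]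
      exact (hweak_p _).const_sub _
    have h2 : Tendsto (fun n => (‖w‖ + (R + 1)) * ‖u (φ n) - -B z‖) atTop (𝓝 0) := by
      simpa using ((tendsto_iff_norm_sub_tendsto_zero.1 hulim).comp hφt).const_mul
        (‖w‖ + (R + 1))
    have hsmall : ∀ᶠ n in atTop, ‖x (φ n) - p (φ n)‖ < 1 := by
      have := (hxp.comp hφt).norm
      rw [norm_zero] at this
      exact this.eventually_lt_const one_pos
    have h3 := h1.add h2
    rw [add_zero] at h3
    refine ge_of_tendsto h3 ?_
    filter_upwards [hsmall] with n hn
    have h4 := hAmono _ _ _ _ hv (huA (φ n))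
    have h5 : v - -B z = (v - u (φ n)) + (u (φ n) - -B z) := by abel
    have h6 : ‖w - p (φ n)‖ ≤ ‖w‖ + (R + 1) := by
      have h7 : ‖p (φ n)‖ ≤ R + 1 := by
        have h8 := norm_sub_norm_le (p (φ n)) (x (φ n))
        rw [norm_sub_rev] at h8
        linarith [hR (φ n)]
      linarith [norm_sub_le w (p (φ n))]
    have h7 : -⟪w - p (φ n), u (φ n) - -B z⟫ ≤ (‖w‖ + (R + 1)) * ‖u (φ n) - -B z‖ :=
      (neg_le_abs _).trans ((abs_real_inner_le_norm _ _).trans (by gcongr))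
    rw [h5, inner_add_right]
    linarith
  have hxbZ : xb ∈ Z := by rw [hZdef]; exact hxbA
  have hsub : Tendsto (fun n => x (φ n)) atTop (𝓝 xb) := by
    rcases hdemi xb hxbZ with hA | hBd
    · have h1 : Tendsto (fun n => p (φ n)) atTop (𝓝 xb) :=
        hA.2 _ (fun n => u (φ n)) (fun n => huA (φ n)) _ hxbA hweak_p
          (by rw [hBxb]; exact hulim.comp hφt)
      simpa using h1.add (hxp.comp hφt)
    · exact hBd.2 _ (fun n => B (x (φ n))) (fun n => rfl) _ rfl hweak
        (by rw [hBxb]; exact hBlim.comp hφt)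
  obtain ⟨⟨L', hL'⟩, -⟩ := hfejer xb hxbZ
  have hsubn : Tendsto (fun n => α⁻¹ * ‖x (φ n) - xb‖ ^ 2) atTop (𝓝 0) := by
    simpa using ((tendsto_iff_norm_sub_tendsto_zero.1 hsub).pow 2).const_mul α⁻¹
  have hL'0 : L' = 0 := tendsto_nhds_unique (hL'.comp hφt)
    (squeeze_zero (fun n => le_trans (by positivity) (hVlow (φ n) _))
      (fun n => hVup (φ n) _) hsubn)
  rw [hL'0] at hL'
  refine ⟨xb, hxbZ, tendsto_iff_norm_sub_tendsto_zero.2 ?_⟩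
  have h : Tendsto (fun n => ‖x n - xb‖ ^ 2) atTop (𝓝 0) := by
    refine squeeze_zero (fun n => by positivity) (fun n => ?_)
      (by simpa only [mul_zero] using hL'.const_mul m⁻¹)
    rw [inv_mul_eq_div, le_div_iff₀ hm, mul_comm]
    exact hVlow n _
  simpa using h.sqrt
end
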